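/- arXiv:1503.04749 — 7 statements merged into one kernel-verified Lean document; each statement's English description precedes it below -/
import Mathlib

section
/- Let 0 < a < 1 and b > 0 be real and c, d ∈ ℂ. Then the function t ↦ (ct+d)³·exp(−t²/5)/(1 − a·e^{ibt})² is integrable on ℝ and ∫_{−∞}^{∞} (ct+d)³·exp(−t²/5)/(1 − a·e^{ibt})² dt = √(5π)·Σ_{m≥0} (m+1)·[ (15/2)·((5/2)·c·i·b·m + d)·c² + ((5/2)·c·i·b·m + d)³ ]·a^m·exp(−(5/4)·b²·m²). -/
open Complex MeasureTheory

/-- A complex polynomial times the Gaussian `exp (-t²/5)` is integrable on `ℝ`. -/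
lemma integrable_polynomial_mul_gaussian (p : Polynomial ℂ) :
    Integrable fun t : ℝ => p.eval (t : ℂ) * Complex.exp (-(t : ℂ) ^ 2 / 5) := by
  induction p using Polynomial.induction_on' with
  | add p q hp hq =>
    exact (hp.add hq).congr (.of_forall fun t => by simp [add_mul])
  | monomial n z =>
    have h := integrable_rpow_mul_exp_neg_mul_sq (b := 1 / 5) (by norm_num) (s := n)
      (by have : (0 : ℝ) ≤ n := n.cast_nonneg
          linarith)
    have h' : Integrable fun t : ℝ => ((t ^ (n : ℝ) * Real.exp (-(1 / 5) * t ^ 2) : ℝ) : ℂ) :=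
      h.ofReal
    refine (h'.const_mul z).congr (.of_forall fun t => ?_)
    have he : -(t : ℂ) ^ 2 / 5 = -(1 / 5) * (t : ℂ) ^ 2 := by ring
    simp only [Polynomial.eval_monomial, Real.rpow_natCast, he]
    push_cast
    ring

/-- A complex polynomial times the modulated Gaussian `exp (-t²/5) * exp (ist)` is integrable. -/
lemma integrable_polynomial_mul_modulated_gaussian (p : Polynomial ℂ) (s : ℝ) :
    Integrable fun t : ℝ => p.eval (t : ℂ) *
      (Complex.exp (-(t : ℂ) ^ 2 / 5) * Complex.exp (Complex.I * s * t)) := by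
  have h := (integrable_polynomial_mul_gaussian p).mul_bdd (c := 1)
    (g := fun t : ℝ => Complex.exp (Complex.I * s * t))
    (by fun_prop) (.of_forall fun t => by simp [Complex.norm_exp])
  simpa only [mul_assoc] using h

/-- The Fourier transform of the Gaussian `exp (-t²/5)`. -/
lemma integral_modulated_gaussian (s : ℝ) :
    ∫ t : ℝ, Complex.exp (-(t : ℂ) ^ 2 / 5) * Complex.exp (Complex.I * s * t)
      = (Real.sqrt (5 * Real.pi) : ℂ) * Complex.exp (-(5 / 4 : ℂ) * s ^ 2) := by
  have h := integral_cexp_quadratic (b := -(1 / 5)) (by norm_num) (Complex.I * s) 0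
  convert h using 1
  · congr with t
    rw [← Complex.exp_add]
    congr 1
    ring
  · congr 1
    · rw [Real.sqrt_eq_rpow, Complex.ofReal_cpow (by positivity)]
      push_cast
      congr 1
      ring
    · congr 1
      rw [mul_pow, Complex.I_sq]
      ring

/-- The integral of a cubic against the modulated Gaussian `exp (-t²/5) * exp (ist)`. -/
lemma integral_cubic_mul_modulated_gaussian (c d : ℂ) (s : ℝ) :
    ∫ t : ℝ, (c * t + d) ^ 3 *
        (Complex.exp (-(t : ℂ) ^ 2 / 5) * Complex.exp (Complex.I * s * t))
      = ((15 / 2) * ((5 / 2) * c * Complex.I * s + d) * c ^ 2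
          + ((5 / 2) * c * Complex.I * s + d) ^ 3) *
        ((Real.sqrt (5 * Real.pi) : ℂ) * Complex.exp (-(5 / 4 : ℂ) * s ^ 2)) := by
  set v : ℂ := (5 / 2) * c * Complex.I * s + d with hv
  set K : ℂ := (15 / 2) * v * c ^ 2 + v ^ 3
  set f : ℝ → ℂ := fun t =>
    Complex.exp (-(t : ℂ) ^ 2 / 5) * Complex.exp (Complex.I * s * t) with hf
  let x : Polynomial ℂ := Polynomial.X - Polynomial.C ((5 / 2) * Complex.I * s)
  let p : Polynomial ℂ := Polynomial.C (-(5 / 2) * c ^ 3) * x ^ 2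
    + Polynomial.C (-(15 / 2) * c ^ 2 * v) * x
    + Polynomial.C (-(25 / 2) * c ^ 3 - (15 / 2) * c * v ^ 2)
  let q : Polynomial ℂ := (Polynomial.C c * Polynomial.X + Polynomial.C d) ^ 3
  have hq : Integrable fun t : ℝ => (c * t + d) ^ 3 * f t := by
    simpa [q] using integrable_polynomial_mul_modulated_gaussian q s
  have hK : Integrable fun t : ℝ => K * f t := by
    simpa using integrable_polynomial_mul_modulated_gaussian (Polynomial.C K) s
  have hderiv (t : ℝ) : HasDerivAt (fun t : ℝ => p.eval (t : ℂ) * f t)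
      ((c * t + d) ^ 3 * f t - K * f t) t := by
    have hg : HasDerivAt (fun z : ℂ => Complex.exp (-z ^ 2 / 5) * Complex.exp (Complex.I * s * z))
        (Complex.exp (-(t : ℂ) ^ 2 / 5) * (-(2 * t) / 5) * Complex.exp (Complex.I * s * t)
          + Complex.exp (-(t : ℂ) ^ 2 / 5) *
            (Complex.exp (Complex.I * s * t) * (Complex.I * s))) (t : ℂ) := by
      refine HasDerivAt.mul (HasDerivAt.cexp ?_) (HasDerivAt.cexp ?_)
      · simpa using ((hasDerivAt_pow 2 (t : ℂ)).neg.div_const 5)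
      · simpa using (hasDerivAt_id (t : ℂ)).const_mul (Complex.I * s)
    refine ((p.hasDerivAt (t : ℂ)).mul hg).comp_ofReal.congr_deriv ?_
    have hd : d = v - (5 / 2) * c * Complex.I * s := by rw [hv]; ring
    simp [p, x, K, f, hd, Polynomial.derivative_pow]
    ring
  have h0 := integral_eq_zero_of_hasDerivAt_of_integrable hderiv (hq.sub hK)
    (integrable_polynomial_mul_modulated_gaussian p s)
  rw [integral_sub hq hK, integral_const_mul, hf, integral_modulated_gaussian, sub_eq_zero] at h0
  exact h0

/-- For `0 < a < 1`, `b > 0` and `c, d ∈ ℂ`, the function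
`t ↦ (ct+d)³·exp(−t²/5)/(1 − a·e^{ibt})²` is integrable on `ℝ` and its integral equals
`√(5π)·Σ_{m≥0} (m+1)·[(15/2)((5/2)cibm+d)c² + ((5/2)cibm+d)³]·a^m·exp(−(5/4)b²m²)`. -/
theorem saddle_point_integral (a b : ℝ) (ha0 : 0 < a) (ha1 : a < 1) (hb : 0 < b)
    (c d : ℂ) :
    Integrable (fun t : ℝ =>
      (c * t + d) ^ 3 * Complex.exp (-(t : ℂ) ^ 2 / 5)
        / (1 - (a : ℂ) * Complex.exp (Complex.I * b * t)) ^ 2) ∧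
    ∫ t : ℝ,
        (c * t + d) ^ 3 * Complex.exp (-(t : ℂ) ^ 2 / 5)
          / (1 - (a : ℂ) * Complex.exp (Complex.I * b * t)) ^ 2
      = (Real.sqrt (5 * Real.pi) : ℂ) *
          ∑' m : ℕ, ((m : ℂ) + 1) *
            ((15 / 2) * ((5 / 2) * c * Complex.I * b * m + d) * c ^ 2
              + ((5 / 2) * c * Complex.I * b * m + d) ^ 3) *
            (a : ℂ) ^ m * Complex.exp (-(5 / 4 : ℂ) * b ^ 2 * m ^ 2) := by
  have hnorm (t : ℝ) : ‖(a : ℂ) * Complex.exp (Complex.I * b * t)‖ = a := by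
    simp [Complex.norm_exp, abs_of_pos ha0]
  have hg : Integrable fun t : ℝ => (c * t + d) ^ 3 * Complex.exp (-(t : ℂ) ^ 2 / 5) := by
    exact (integrable_polynomial_mul_gaussian
      ((Polynomial.C c * Polynomial.X + Polynomial.C d) ^ 3)).congr (.of_forall fun t => by simp)
  constructor
  · simp only [div_eq_mul_inv (_ * _)]
    refine hg.mul_bdd (c := ((1 - a) ^ 2)⁻¹) (Measurable.aestronglyMeasurable (by fun_prop))
      (.of_forall fun t => ?_)
    rw [norm_inv, norm_pow]
    have h := norm_sub_norm_le 1 ((a : ℂ) * Complex.exp (Complex.I * b * t))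
    rw [hnorm, norm_one] at h
    have : 0 < 1 - a := by linarith
    gcongr
  · let F : ℕ → ℝ → ℂ := fun m t => (((m : ℂ) + 1) * (a : ℂ) ^ m) *
      ((c * t + d) ^ 3 *
        (Complex.exp (-(t : ℂ) ^ 2 / 5) * Complex.exp (Complex.I * (b * m : ℝ) * t)))
    have hF (m : ℕ) : Integrable (F m) := by
      refine Integrable.const_mul ?_ _
      exact (integrable_polynomial_mul_modulated_gaussian
        ((Polynomial.C c * Polynomial.X + Polynomial.C d) ^ 3) (b * m)).congr
          (.of_forall fun t => by
            simp only [Polynomial.eval_pow, Polynomial.eval_add, Polynomial.eval_mul,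
              Polynomial.eval_C, Polynomial.eval_X])
    have hFnorm (m : ℕ) (t : ℝ) : ‖F m t‖ = (((m : ℝ) + 1) * a ^ m) *
        ‖(c * t + d) ^ 3 * Complex.exp (-(t : ℂ) ^ 2 / 5)‖ := by
      have h1 : ‖(m : ℂ) + 1‖ = m + 1 := by exact_mod_cast Complex.norm_natCast (m + 1)
      have h2 : ‖Complex.exp (Complex.I * (b * m : ℝ) * t)‖ = 1 := by simp [Complex.norm_exp]
      simp only [F, norm_mul, norm_pow, h1, h2, Complex.norm_real, Real.norm_of_nonneg ha0.le,
        mul_one]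
    have hsum : Summable fun m : ℕ => ∫ t, ‖F m t‖ := by
      simp only [hFnorm, integral_const_mul]
      refine Summable.mul_right _ ?_
      simpa using summable_choose_mul_geometric_of_norm_lt_one 1 (r := a)
        (by rwa [Real.norm_of_nonneg ha0.le])
    have hpoint (t : ℝ) : ∑' m, F m t = (c * t + d) ^ 3 * Complex.exp (-(t : ℂ) ^ 2 / 5)
        / (1 - (a : ℂ) * Complex.exp (Complex.I * b * t)) ^ 2 := by
      have h := (hasSum_choose_mul_geometric_of_norm_lt_one 1
        ((hnorm t).trans_lt ha1)).mul_left ((c * t + d) ^ 3 * Complex.exp (-(t : ℂ) ^ 2 / 5))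
      rw [mul_one_div] at h
      refine Eq.trans (tsum_congr fun m => ?_) h.tsum_eq
      have he : Complex.exp (Complex.I * (b * m : ℝ) * t)
          = Complex.exp (Complex.I * b * t) ^ m := by
        rw [← Complex.exp_nat_mul]
        congr 1
        push_cast
        ring
      simp only [F, he, Nat.choose_one_right, Nat.cast_add, Nat.cast_one, mul_pow]
      ring
    simp only [← hpoint]
    rw [← integral_tsum_of_summable_integral_norm hF hsum, ← tsum_mul_left]
    refine tsum_congr fun m => ?_
    simp only [F]
    rw [integral_const_mul, integral_cubic_mul_modulated_gaussian]
    push_cast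
    ring_nf
end

section
/- For every real α > 0, Σ_{m≥1} (2α²m² − 3)·m²·exp(−α²m²) = (π^{5/2}/α⁵)·Σ_{m≥1} ( 2·(π/α)²·m² − 3 )·m²·exp( −(π/α)²·m² ). -/
open Real

/-- The moments `∑ m ≥ 1, m ^ (2 * k) * exp (-s * m ^ 2)` of the discrete Gaussian. -/
noncomputable def gaussianMoment (k : ℕ) (s : ℝ) : ℝ :=
  ∑' m : ℕ, ((m : ℝ) + 1) ^ (2 * k) * Real.exp (-s * ((m : ℝ) + 1) ^ 2)

theorem summable_gaussianMoment (k : ℕ) {s : ℝ} (hs : 0 < s) :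
    Summable fun m : ℕ => ((m : ℝ) + 1) ^ (2 * k) * Real.exp (-s * ((m : ℝ) + 1) ^ 2) := by
  have h := (summable_nat_add_iff 1).mpr (Real.summable_pow_mul_exp_neg_nat_mul (2 * k) hs)
  refine Summable.of_nonneg_of_le (fun m => by positivity) (fun m => ?_) h
  push_cast
  refine mul_le_mul_of_nonneg_left (Real.exp_le_exp.mpr ?_) (by positivity)
  nlinarith [mul_nonneg hs.le (mul_nonneg m.cast_nonneg (by positivity : (0 : ℝ) ≤ m + 1))]

theorem hasDerivAt_gaussianMoment (k : ℕ) {s : ℝ} (hs : 0 < s) :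
    HasDerivAt (gaussianMoment k) (-gaussianMoment (k + 1) s) s := by
  unfold gaussianMoment
  rw [← tsum_neg]
  have hmem : s ∈ Set.Ioi (s / 2) := Set.mem_Ioi.mpr (half_lt_self hs)
  refine hasDerivAt_tsum_of_isPreconnected
    (g := fun (m : ℕ) y => ((m : ℝ) + 1) ^ (2 * k) * Real.exp (-y * ((m : ℝ) + 1) ^ 2))
    (g' := fun (m : ℕ) y =>
      -(((m : ℝ) + 1) ^ (2 * (k + 1)) * Real.exp (-y * ((m : ℝ) + 1) ^ 2)))
    (summable_gaussianMoment (k + 1) (half_pos hs)) isOpen_Ioi isPreconnected_Ioi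
    (fun m y _ => ?_) (fun m y hy => ?_) hmem (summable_gaussianMoment k hs) hmem
  · have h := (((hasDerivAt_id y).neg.mul_const (((m : ℝ) + 1) ^ 2)).exp).const_mul
      (((m : ℝ) + 1) ^ (2 * k))
    refine h.congr_deriv ?_
    simp only [Pi.neg_apply, id_eq]
    ring
  · rw [norm_neg, Real.norm_of_nonneg (by positivity)]
    have : s / 2 ≤ y := le_of_lt hy
    gcongr

/-- Jacobi's theta transformation, written with the positive half of the theta series. -/
theorem gaussianMoment_zero_sq {x : ℝ} (hx : 0 < x) :
    1 + 2 * gaussianMoment 0 (x ^ 2) =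
      √π / x * (1 + 2 * gaussianMoment 0 ((π / x) ^ 2)) := by
  have key : ∀ s : ℝ, 0 < s →
      ∑' n : ℤ, Real.exp (-s * (n : ℝ) ^ 2) = 1 + 2 * gaussianMoment 0 s := by
    intro s hs
    have h : HasSum (fun m : ℕ => Real.exp (-s * ((m : ℝ) + 1) ^ 2)) (gaussianMoment 0 s) := by
      simpa [gaussianMoment] using (summable_gaussianMoment 0 hs).hasSum
    have h' : HasSum (fun m : ℕ => Real.exp (-s * (((-(m + 1 : ℤ) : ℤ)) : ℝ) ^ 2))
        (gaussianMoment 0 s) := by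
      refine h.congr_fun fun m => ?_
      push_cast
      ring_nf
    have h0 := HasSum.of_add_one_of_neg_add_one (f := fun n : ℤ => Real.exp (-s * (n : ℝ) ^ 2))
      (by simpa using h) h'
    rw [h0.tsum_eq]
    simp
    ring
  have h := Real.tsum_exp_neg_mul_int_sq (a := x ^ 2 / π) (by positivity)
  have e1 : -π * (x ^ 2 / π) = -x ^ 2 := by field_simp
  have e2 : -π / (x ^ 2 / π) = -(π / x) ^ 2 := by field_simp
  rw [e1, e2, key _ (by positivity), key _ (by positivity), ← Real.sqrt_eq_rpow,
    Real.sqrt_div (by positivity), Real.sqrt_sq hx.le, one_div_div] at h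
  exact h

theorem hasDerivAt_gaussianMoment_sq (k : ℕ) {x : ℝ} (hx : 0 < x) :
    HasDerivAt (fun y => gaussianMoment k (y ^ 2))
      (-(2 * x * gaussianMoment (k + 1) (x ^ 2))) x := by
  have h := HasDerivAt.comp (h := fun y : ℝ => y ^ 2) x
    (hasDerivAt_gaussianMoment k (pow_pos hx 2)) (hasDerivAt_pow 2 x)
  refine h.congr_deriv ?_
  push_cast
  ring

theorem hasDerivAt_gaussianMoment_div_sq (k : ℕ) {x : ℝ} (hx : 0 < x) :
    HasDerivAt (fun y => gaussianMoment k ((π / y) ^ 2))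
      (2 * π ^ 2 / x ^ 3 * gaussianMoment (k + 1) ((π / x) ^ 2)) x := by
  have h := HasDerivAt.comp (h := fun y : ℝ => π / y) x
    (hasDerivAt_gaussianMoment_sq k (div_pos pi_pos hx)) ((hasDerivAt_inv hx.ne').const_mul π)
  refine h.congr_deriv ?_
  field_simp

/-- The derivative of Jacobi's theta transformation. -/
theorem gaussianMoment_one_sq {x : ℝ} (hx : 0 < x) :
    4 * x ^ 3 * gaussianMoment 1 (x ^ 2) =
      √π * (1 + 2 * gaussianMoment 0 ((π / x) ^ 2)) -
        4 * √π * π ^ 2 * (x⁻¹ ^ 2 * gaussianMoment 1 ((π / x) ^ 2)) := by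
  have hl := ((hasDerivAt_gaussianMoment_sq 0 hx).const_mul 2).const_add 1
  have hr := ((hasDerivAt_inv hx.ne').const_mul √π).mul
    (((hasDerivAt_gaussianMoment_div_sq 0 hx).const_mul 2).const_add 1)
  have h := hl.unique (hr.congr_of_eventuallyEq
    ((eventually_gt_nhds hx).mono fun y hy => gaussianMoment_zero_sq hy))
  simp only [zero_add] at h
  field_simp at h ⊢
  linear_combination -h

/-- The second derivative of Jacobi's theta transformation. -/
theorem gaussianMoment_two_sq {x : ℝ} (hx : 0 < x) :
    2 * x ^ 2 * gaussianMoment 2 (x ^ 2) - 3 * gaussianMoment 1 (x ^ 2) =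
      √π * π ^ 2 / x ^ 5 * (2 * (π / x) ^ 2 * gaussianMoment 2 ((π / x) ^ 2) -
        3 * gaussianMoment 1 ((π / x) ^ 2)) := by
  have hl := ((hasDerivAt_pow 3 x).const_mul 4).mul (hasDerivAt_gaussianMoment_sq 1 hx)
  have hr := ((((hasDerivAt_gaussianMoment_div_sq 0 hx).const_mul 2).const_add 1).const_mul
    √π).sub ((((hasDerivAt_inv hx.ne').pow 2).mul
      (hasDerivAt_gaussianMoment_div_sq 1 hx)).const_mul (4 * √π * π ^ 2))
  have h := hl.unique (hr.congr_of_eventuallyEq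
    ((eventually_gt_nhds hx).mono fun y hy => gaussianMoment_one_sq hy))
  norm_num at h
  field_simp at h ⊢
  linear_combination (-1 / 4) * h

theorem tsum_eq_gaussianMoment {x : ℝ} (hx : 0 < x) :
    ∑' m : ℕ, (2 * x ^ 2 * ((m : ℝ) + 1) ^ 2 - 3) * ((m : ℝ) + 1) ^ 2 *
        Real.exp (-(x ^ 2) * ((m : ℝ) + 1) ^ 2) =
      2 * x ^ 2 * gaussianMoment 2 (x ^ 2) - 3 * gaussianMoment 1 (x ^ 2) := by
  unfold gaussianMoment
  rw [← tsum_mul_left, ← tsum_mul_left, ← Summable.tsum_sub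
    ((summable_gaussianMoment 2 (pow_pos hx 2)).mul_left _)
    ((summable_gaussianMoment 1 (pow_pos hx 2)).mul_left _)]
  refine tsum_congr fun m => ?_
  ring

/-- Poisson summation identity for `G(α)`: for every `α > 0`,
`Σ_{m≥1} (2α²m² − 3)m²·e^{−α²m²}
  = (π^{5/2}/α⁵)·Σ_{m≥1} (2(π/α)²m² − 3)m²·e^{−(π/α)²m²}`. -/
theorem G_poisson (α : ℝ) (hα : 0 < α) :
    ∑' m : ℕ, (2 * α ^ 2 * ((m : ℝ) + 1) ^ 2 - 3) * ((m : ℝ) + 1) ^ 2 *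
        Real.exp (-(α ^ 2) * ((m : ℝ) + 1) ^ 2)
      = (Real.sqrt (Real.pi ^ 5) / α ^ 5) *
          ∑' m : ℕ, (2 * (Real.pi / α) ^ 2 * ((m : ℝ) + 1) ^ 2 - 3) * ((m : ℝ) + 1) ^ 2 *
            Real.exp (-((Real.pi / α) ^ 2) * ((m : ℝ) + 1) ^ 2) := by
  have e : √(π ^ 5) = √π * π ^ 2 := by
    rw [show π ^ 5 = π * (π ^ 2) ^ 2 by ring, Real.sqrt_mul pi_pos.le,
      Real.sqrt_sq (by positivity)]
  rw [tsum_eq_gaussianMoment hα, tsum_eq_gaussianMoment (div_pos pi_pos hα), e]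
  exact gaussianMoment_two_sq hα
end

section
/- For n ≥ 1 and 2 ≤ k ≤ n+1, the number of rooted plane multi-edge trees with n edges and k vertices equals (1/k)·C(2k−2, k−1)·C(n−1, k−2). -/
/-- A rooted plane multi-edge tree: an ordered list of subtrees, each attached to the
root by a positive number of parallel edges (`m + 1` edges, where `m : ℕ`). -/
inductive MTree : Type
  | node : List (ℕ × MTree) → MTree

/-- The number of edges of a multi-edge tree. -/
def MTree.edges : MTree → ℕ
  | .node l => go l
where
  go : List (ℕ × MTree) → ℕ
    | [] => 0
    | (m, t) :: rest => (m + 1) + t.edges + go rest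

/-- The number of vertices of a multi-edge tree. -/
def MTree.vertices : MTree → ℕ
  | .node l => 1 + go l
where
  go : List (ℕ × MTree) → ℕ
    | [] => 0
    | (_, t) :: rest => t.vertices + go rest

namespace MTree

/-- The binary tree corresponding to the underlying plane tree, under the
left-child right-sibling correspondence. -/
def shape : MTree → BinaryTree Unit
  | .node l => go l
where
  go : List (ℕ × MTree) → BinaryTree Unit
    | [] => .nil
    | (_, t) :: rest => .node () t.shape (go rest)

/-- The edge multiplicities (each decreased by one), listed in preorder. -/
def labels : MTree → List ℕ
  | .node l => go l
where
  go : List (ℕ × MTree) → List ℕ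
    | [] => []
    | (m, t) :: rest => m :: (t.labels ++ go rest)

theorem induction_forest {P : MTree → Prop} (nil : P (node []))
    (cons : ∀ m t l, P t → P (node l) → P (node ((m, t) :: l))) (t : MTree) : P t :=
  MTree.rec (motive_1 := P) (motive_2 := fun l ↦ P (node l)) (motive_3 := fun p ↦ P p.2)
    (fun _ h ↦ h) nil (fun p l hp hl ↦ cons p.1 p.2 l hp hl) (fun _ _ h ↦ h) t

@[simp] theorem edges_nil : (node []).edges = 0 := by simp [edges, edges.go]

@[simp] theorem edges_cons (m : ℕ) (t : MTree) (l : List (ℕ × MTree)) :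
    (node ((m, t) :: l)).edges = m + 1 + t.edges + (node l).edges := by simp [edges, edges.go]

@[simp] theorem vertices_nil : (node []).vertices = 1 := by simp [vertices, vertices.go]

@[simp] theorem vertices_cons (m : ℕ) (t : MTree) (l : List (ℕ × MTree)) :
    (node ((m, t) :: l)).vertices = t.vertices + (node l).vertices := by
  simp only [vertices, vertices.go]
  omega

@[simp] theorem shape_nil : (node []).shape = .nil := by simp [shape, shape.go]

@[simp] theorem shape_cons (m : ℕ) (t : MTree) (l : List (ℕ × MTree)) :
    (node ((m, t) :: l)).shape = .node () t.shape (node l).shape := by simp [shape, shape.go]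

@[simp] theorem labels_nil : (node []).labels = [] := by simp [labels, labels.go]

@[simp] theorem labels_cons (m : ℕ) (t : MTree) (l : List (ℕ × MTree)) :
    (node ((m, t) :: l)).labels = m :: (t.labels ++ (node l).labels) := by
  simp [labels, labels.go]

theorem length_labels (t : MTree) : t.labels.length = t.shape.numNodes := by
  induction t using induction_forest with
  | nil => simp
  | cons m t l ht hl => simp [ht, hl]

theorem vertices_eq (t : MTree) : t.vertices = t.shape.numNodes + 1 := by
  induction t using induction_forest with
  | nil => simp
  | cons m t l ht hl => simp only [vertices_cons, ht, hl, shape_cons, BinaryTree.numNodes]; omega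

theorem edges_eq (t : MTree) : t.edges = t.labels.sum + t.shape.numNodes := by
  induction t using induction_forest with
  | nil => simp
  | cons m t l ht hl =>
    simp only [edges_cons, ht, hl, labels_cons, shape_cons, BinaryTree.numNodes, List.sum_cons,
      List.sum_append]
    omega

theorem shape_labels_injective : Function.Injective fun t : MTree ↦ (t.shape, t.labels) := by
  intro s
  induction s using induction_forest with
  | nil =>
    rintro ⟨_ | ⟨⟨m, t⟩, l⟩⟩ h
    · rfl
    · simp at h
  | cons m t l ht hl =>
    rintro ⟨_ | ⟨⟨m', t'⟩, l'⟩⟩ h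
    · simp at h
    · simp only [shape_cons, labels_cons, Prod.mk.injEq, BinaryTree.node.injEq, true_and,
        List.cons.injEq] at h
      obtain ⟨⟨hs, hs'⟩, rfl, h⟩ := h
      obtain ⟨h₁, h₂⟩ := List.append_inj h (by rw [length_labels, length_labels, hs])
      rw [ht (Prod.ext hs h₁), node.inj (hl (Prod.ext hs' h₂))]

theorem exists_shape_labels_eq (s : BinaryTree Unit) (v : List ℕ) (h : v.length = s.numNodes) :
    ∃ t : MTree, t.shape = s ∧ t.labels = v := by
  induction s generalizing v with
  | nil => exact ⟨node [], by simp, by simpa [eq_comm] using h⟩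
  | node _ a b ha hb =>
    obtain _ | ⟨m, v⟩ := v
    · simp at h
    · simp only [List.length_cons, BinaryTree.numNodes, Nat.add_right_cancel_iff] at h
      obtain ⟨t, rfl, ht⟩ := ha (v.take a.numNodes) (by simp [h])
      obtain ⟨⟨l⟩, rfl, hl⟩ := hb (v.drop t.shape.numNodes) (by simp [h])
      exact ⟨node ((m, t) :: l), by simp, by simp [ht, hl]⟩

end MTree

theorem List.ncard_length_eq_sum_eq (j w : ℕ) :
    {l : List ℕ | l.length = j ∧ l.sum = w}.ncard = j.multichoose w := by
  rw [← Sym.card_sym_fin_eq_multichoose, ← Nat.card_eq_fintype_card, ← Nat.card_coe_set_eq]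
  refine Nat.card_congr (Equiv.trans ?_ (Sym.equivNatSumOfFintype (Fin j) w).symm)
  refine (Equiv.subtypeSubtypeEquivSubtypeInter (fun l : List ℕ ↦ l.length = j)
    (fun l ↦ l.sum = w)).symm.trans ((Equiv.vectorEquivFin ℕ j).subtypeEquiv ?_)
  rintro ⟨l, rfl⟩
  simp [Equiv.vectorEquivFin, List.Vector.get, ← List.sum_ofFn]

theorem MTree.ncard_edges_vertices (j w : ℕ) :
    {t : MTree | t.edges = w + j ∧ t.vertices = j + 1}.ncard = catalan j * j.multichoose w := by
  rw [← Set.ncard_image_of_injective _ shape_labels_injective,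
    ← BinaryTree.treesOfNumNodesEq_card_eq_catalan, ← List.ncard_length_eq_sum_eq,
    ← Set.ncard_coe_finset, ← Set.ncard_prod]
  congr 1
  ext ⟨s, v⟩
  simp only [Set.mem_image, Set.mem_ofPred_eq, Set.mem_prod, BinaryTree.coe_treesOfNumNodesEq,
    Prod.mk.injEq]
  constructor
  · rintro ⟨t, ⟨he, hv⟩, rfl, rfl⟩
    rw [edges_eq] at he
    rw [vertices_eq] at hv
    exact ⟨by omega, by rw [length_labels]; omega, by omega⟩
  · rintro ⟨rfl, hl, rfl⟩
    obtain ⟨t, rfl, rfl⟩ := exists_shape_labels_eq s v hl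
    exact ⟨t, ⟨t.edges_eq, t.vertices_eq⟩, rfl, rfl⟩

theorem count_trees (n k : ℕ) (hn : 1 ≤ n) (hk2 : 2 ≤ k) (hk : k ≤ n + 1) :
    (Nat.card {t : MTree // t.edges = n ∧ t.vertices = k} : ℚ)
      = (1 / k : ℚ) * Nat.choose (2 * k - 2) (k - 1) * Nat.choose (n - 1) (k - 2) := by
  obtain ⟨j, rfl⟩ := Nat.exists_eq_add_of_le' hk2
  obtain ⟨w, rfl⟩ := Nat.exists_eq_add_of_le' (show j + 1 ≤ n by omega)
  have hcard : Nat.card {t : MTree // t.edges = w + (j + 1) ∧ t.vertices = j + 2} =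
      catalan (j + 1) * (j + w).choose j := by
    rw [Nat.choose_symm_add, ← Nat.add_sub_cancel (n := j + w) (m := 1), Nat.add_right_comm,
      ← Nat.multichoose_eq, ← MTree.ncard_edges_vertices]
    rfl
  have hcat : ((j + 2 : ℕ) : ℚ) * catalan (j + 1) = (2 * (j + 1)).choose (j + 1) :=
    mod_cast succ_mul_catalan_eq_centralBinom (j + 1)
  rw [hcard, show 2 * (j + 2) - 2 = 2 * (j + 1) by omega, show j + 2 - 1 = j + 1 by omega,
    show w + (j + 1) - 1 = j + w by omega, Nat.add_sub_cancel, ← hcat]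
  have : ((j + 2 : ℕ) : ℚ) ≠ 0 := by positivity
  push_cast at this ⊢
  field_simp
end

section
/- Let A_n = Σ_{k=2}^{n+1} (1/k)·C(2k−2, k−1)·C(n−1, k−2) for n ≥ 1 (the number of rooted plane multi-edge trees with n edges). Then A_n = ( 5^{n+1/2} / (2·√(π·n³)) )·(1 + O(1/n)) as n → ∞. -/
open Filter Asymptotics

/-- `A_{n,k} = (1/k)·C(2k−2,k−1)·C(n−1,k−2)`, the number of rooted plane multi-edge
trees with `n` edges and `k` vertices. -/
noncomputable def Ank (n k : ℕ) : ℚ :=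
  (1 / k : ℚ) * Nat.choose (2 * k - 2) (k - 1) * Nat.choose (n - 1) (k - 2)

/-- `A_n = Σ_{k=2}^{n+1} A_{n,k}`, the number of rooted plane multi-edge trees
with `n` edges. -/
noncomputable def A (n : ℕ) : ℚ := ∑ k ∈ Finset.Icc 2 (n + 1), Ank n k

/-- The Euler beta integral over the reals. -/
theorem integral_rpow_mul_one_sub_rpow {a b : ℝ} (ha : 0 < a) (hb : 0 < b) :
    ∫ x in (0 : ℝ)..1, x ^ (a - 1) * (1 - x) ^ (b - 1) = ProbabilityTheory.beta a b := by
  have h : Complex.betaIntegral a b =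
      ((∫ x in (0 : ℝ)..1, x ^ (a - 1) * (1 - x) ^ (b - 1) : ℝ) : ℂ) := by
    rw [Complex.betaIntegral, ← intervalIntegral.integral_ofReal]
    refine intervalIntegral.integral_congr fun x hx => ?_
    rw [Set.uIcc_of_le zero_le_one] at hx
    have hx1 : 0 ≤ 1 - x := by linarith [hx.2]
    simp only [Complex.ofReal_mul]
    rw [Complex.ofReal_cpow hx.1, Complex.ofReal_cpow hx1]
    push_cast
    rfl
  rw [ProbabilityTheory.beta_eq_betaIntegralReal a b ha hb, h, Complex.ofReal_re]

theorem pow_mul_sqrt_eq_rpow {x : ℝ} (hx : 0 ≤ x) (j : ℕ) :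
    x ^ j * √x = x ^ ((j + 3 / 2 : ℝ) - 1) := by
  rw [Real.sqrt_eq_rpow, ← Real.rpow_natCast, ← Real.rpow_add_of_nonneg hx (by positivity)
    (by positivity)]
  congr 1
  ring

theorem beta_add_one_left {a b : ℝ} (ha : 0 < a) (hb : 0 < b) :
    ProbabilityTheory.beta (a + 1) b = a / (a + b) * ProbabilityTheory.beta a b := by
  have hab : a + b ≠ 0 := by positivity
  have hG : Real.Gamma (a + b) ≠ 0 := (Real.Gamma_pos_of_pos (by positivity)).ne'
  rw [ProbabilityTheory.beta, ProbabilityTheory.beta, add_right_comm, Real.Gamma_add_one ha.ne',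
    Real.Gamma_add_one hab]
  field_simp

theorem Gamma_three_halves : Real.Gamma (3 / 2) = √Real.pi / 2 := by
  rw [show (3 / 2 : ℝ) = 1 / 2 + 1 by norm_num, Real.Gamma_add_one (by norm_num),
    Real.Gamma_one_half_eq]
  ring

theorem beta_half_integer (j : ℕ) :
    ProbabilityTheory.beta (j + 3 / 2) (3 / 2) =
      2 * Real.pi / 4 ^ (j + 2) * (Nat.centralBinom (j + 1) / (j + 2)) := by
  induction j with
  | zero =>
    have h3 : Real.Gamma (3 / 2 + 3 / 2) = 2 := by
      rw [show (3 / 2 + 3 / 2 : ℝ) = (2 : ℕ) + 1 by norm_num, Real.Gamma_nat_eq_factorial]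
      norm_num
    rw [ProbabilityTheory.beta, Nat.cast_zero, zero_add, h3, Gamma_three_halves]
    have := Real.mul_self_sqrt Real.pi_pos.le
    have hc : Nat.centralBinom 1 = 2 := rfl
    rw [zero_add, zero_add, zero_add, hc]
    push_cast
    linear_combination this / 8
  | succ j ih =>
    have hc : ((j : ℝ) + 2) * Nat.centralBinom (j + 2) =
        2 * (2 * (j + 1) + 1) * Nat.centralBinom (j + 1) := by
      have := Nat.succ_mul_centralBinom_succ (j + 1)
      have h := congrArg (Nat.cast : ℕ → ℝ) this
      push_cast at h
      linear_combination h
    have hc' : (Nat.centralBinom (j + 2) : ℝ) =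
        2 * (2 * (j + 1) + 1) * Nat.centralBinom (j + 1) / (j + 2) := by
      field_simp
      linear_combination hc
    push_cast
    rw [show (j : ℝ) + 1 + 3 / 2 = (j + 3 / 2) + 1 by ring,
      beta_add_one_left (by positivity) (by norm_num), ih, show j + 1 + 1 = j + 2 by ring, hc']
    have h1 : (j : ℝ) + 3 / 2 + 3 / 2 ≠ 0 := by positivity
    have h2 : (j : ℝ) + 1 + 2 ≠ 0 := by positivity
    field_simp
    ring

/-- The moments of the semicircle weight on `[0, 1]` are rescaled Catalan numbers. -/
theorem integral_pow_mul_semicircle (j : ℕ) :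
    ∫ x in (0 : ℝ)..1, x ^ j * (√x * √(1 - x)) =
      2 * Real.pi / 4 ^ (j + 2) * (Nat.centralBinom (j + 1) / (j + 2)) := by
  rw [← beta_half_integer, ← integral_rpow_mul_one_sub_rpow (by positivity) (by norm_num)]
  refine intervalIntegral.integral_congr fun x hx => ?_
  rw [Set.uIcc_of_le zero_le_one] at hx
  have h := pow_mul_sqrt_eq_rpow (sub_nonneg.2 hx.2) 0
  simp only [pow_zero, one_mul, Nat.cast_zero, zero_add] at h
  simp only [← mul_assoc]
  rw [pow_mul_sqrt_eq_rpow hx.1, h]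

theorem A_succ_eq_sum (m : ℕ) :
    (A (m + 1) : ℝ) =
      ∑ j ∈ Finset.range (m + 1), (Nat.centralBinom (j + 1) / (j + 2) : ℝ) * m.choose j := by
  have hI : Finset.Icc 2 (m + 1 + 1) = Finset.Ico 2 (m + 3) := by
    ext k
    simp only [Finset.mem_Icc, Finset.mem_Ico]
    omega
  rw [A, hI, Finset.sum_Ico_eq_sum_range, Rat.cast_sum, show m + 3 - 2 = m + 1 by omega]
  refine Finset.sum_congr rfl fun j _ => ?_
  rw [Ank, show 2 * (2 + j) - 2 = 2 * (j + 1) by omega, show 2 + j - 1 = j + 1 by omega,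
    show 2 + j - 2 = j by omega, Nat.add_sub_cancel, ← Nat.centralBinom_eq_two_mul_choose]
  push_cast
  rw [add_comm (2 : ℝ)]
  ring

theorem A_succ_eq_semicircle_integral (m : ℕ) :
    (A (m + 1) : ℝ) =
      8 / Real.pi * ∫ x in (0 : ℝ)..1, (4 * x + 1) ^ m * (√x * √(1 - x)) := by
  have hexp : ∀ x : ℝ, (4 * x + 1) ^ m * (√x * √(1 - x)) =
      ∑ j ∈ Finset.range (m + 1), (4 ^ j * m.choose j : ℝ) * (x ^ j * (√x * √(1 - x))) := by
    intro x
    rw [add_pow, Finset.sum_mul]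
    refine Finset.sum_congr rfl fun j _ => ?_
    rw [one_pow, mul_pow]
    ring
  simp_rw [hexp]
  rw [intervalIntegral.integral_finsetSum
    (fun j _ => Continuous.intervalIntegrable (by fun_prop) _ _), A_succ_eq_sum, Finset.mul_sum]
  refine Finset.sum_congr rfl fun j _ => ?_
  rw [intervalIntegral.integral_const_mul, integral_pow_mul_semicircle, pow_add]
  have := Real.pi_pos
  field_simp
  ring

/-- `A (m + 1)` as a Laplace-type integral; the factor `√(4 - 5 * t)` vanishes for `t ≥ 4 / 5`. -/
theorem A_succ_eq_laplace_integral (m : ℕ) :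
    (A (m + 1) : ℝ) = √5 * 5 ^ (m + 1) / (2 * Real.pi) *
      ∫ t in (0 : ℝ)..1, (1 - t) ^ m * (√t * √(4 - 5 * t)) := by
  set g : ℝ → ℝ := fun t => (1 - t) ^ m * (√t * √(4 - 5 * t)) with hg
  have hgc : Continuous g := by fun_prop
  have htail : ∫ t in (4 / 5 : ℝ)..1, g t = 0 := by
    refine intervalIntegral.integral_zero_ae (Eventually.of_forall fun t ht => ?_)
    rw [Set.uIoc_of_le (by norm_num)] at ht
    rw [hg]
    simp only
    rw [Real.sqrt_eq_zero_of_nonpos (x := 4 - 5 * t) (by linarith [ht.1]), mul_zero, mul_zero]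
  have hsplit : ∫ t in (0 : ℝ)..1, g t = ∫ t in (0 : ℝ)..(4 / 5), g t := by
    rw [← intervalIntegral.integral_add_adjacent_intervals
      (hgc.intervalIntegrable 0 (4 / 5)) (hgc.intervalIntegrable (4 / 5) 1), htail, add_zero]
  have hsubst := intervalIntegral.integral_comp_sub_mul g (a := 0) (b := 1)
    (c := (4 / 5 : ℝ)) (by norm_num) (4 / 5)
  have hpt : ∀ x : ℝ, g (4 / 5 - 4 / 5 * x) =
      4 / (√5 * 5 ^ m) * ((4 * x + 1) ^ m * (√x * √(1 - x))) := by
    intro x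
    have h1 : (1 - (4 / 5 - 4 / 5 * x)) = (4 * x + 1) / 5 := by ring
    have h2 : √(4 / 5 - 4 / 5 * x) = 2 / √5 * √(1 - x) := by
      rw [show 4 / 5 - 4 / 5 * x = (2 ^ 2 / 5) * (1 - x) by ring,
        Real.sqrt_mul (by norm_num), Real.sqrt_div (by norm_num), Real.sqrt_sq (by norm_num)]
    have h3 : √(4 - 5 * (4 / 5 - 4 / 5 * x)) = 2 * √x := by
      rw [show 4 - 5 * (4 / 5 - 4 / 5 * x) = 2 ^ 2 * x by ring,
        Real.sqrt_mul (by norm_num), Real.sqrt_sq (by norm_num)]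
    rw [hg]
    simp only
    rw [h1, h2, h3, div_pow]
    field_simp
    ring
  simp_rw [hpt] at hsubst
  rw [intervalIntegral.integral_const_mul] at hsubst
  norm_num at hsubst
  rw [hsplit, A_succ_eq_semicircle_integral]
  have h5 : √(5 : ℝ) ≠ 0 := by positivity
  have hI : ∫ t in (0 : ℝ)..(4 / 5), g t = 4 / 5 * (4 / (√5 * 5 ^ m) *
      ∫ x in (0 : ℝ)..1, (4 * x + 1) ^ m * (√x * √(1 - x))) := by
    rw [hsubst]
    ring
  rw [hI, pow_succ]
  generalize (∫ x in (0 : ℝ)..1, (4 * x + 1) ^ m * (√x * √(1 - x))) = J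
  have := Real.pi_pos
  field_simp
  ring

theorem Gamma_add_half_le {x : ℝ} (hx : 0 < x) :
    Real.Gamma (x + 1 / 2) ≤ √x * Real.Gamma x := by
  have h := Real.Gamma_mul_add_mul_le_rpow_Gamma_mul_rpow_Gamma hx (add_pos hx one_pos)
    (a := 1 / 2) (b := 1 / 2) (by norm_num) (by norm_num) (by norm_num)
  have hG := (Real.Gamma_pos_of_pos hx).le
  rw [show 1 / 2 * x + 1 / 2 * (x + 1) = x + 1 / 2 by ring, Real.Gamma_add_one hx.ne',
    ← Real.sqrt_eq_rpow, ← Real.sqrt_eq_rpow, Real.sqrt_mul hx.le] at h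
  calc _ ≤ _ := h
    _ = √x * (√(Real.Gamma x) * √(Real.Gamma x)) := by ring
    _ = _ := by rw [Real.mul_self_sqrt hG]

theorem Gamma_ratio_le_one {x : ℝ} (hx : 0 < x) :
    x * √x * (Real.Gamma x / Real.Gamma (x + 3 / 2)) ≤ 1 := by
  have hG := Real.Gamma_pos_of_pos (show 0 < x + 1 / 2 by positivity)
  have h := Gamma_add_half_le (show 0 < x + 1 / 2 by positivity)
  rw [show x + 1 / 2 + 1 / 2 = x + 1 by ring, Real.Gamma_add_one hx.ne'] at h
  rw [show x + 3 / 2 = (x + 1 / 2) + 1 by ring, Real.Gamma_add_one (by positivity), ← mul_div_assoc,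
    div_le_one (by positivity)]
  have hs : √x ≤ √(x + 1 / 2) := Real.sqrt_le_sqrt (by linarith)
  calc x * √x * Real.Gamma x = √x * (x * Real.Gamma x) := by ring
    _ ≤ √(x + 1 / 2) * (√(x + 1 / 2) * Real.Gamma (x + 1 / 2)) := by
      have := Real.Gamma_pos_of_pos hx
      gcongr
    _ = _ := by rw [← mul_assoc, Real.mul_self_sqrt (by positivity)]

theorem one_sub_le_Gamma_ratio {x : ℝ} (hx : 0 < x) :
    1 - 1 / (2 * x) ≤ x * √x * (Real.Gamma x / Real.Gamma (x + 3 / 2)) := by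
  have hG := Real.Gamma_pos_of_pos (show 0 < x + 1 / 2 by positivity)
  have hGx := Real.Gamma_pos_of_pos hx
  have h := Gamma_add_half_le hx
  have hx1 : 1 - 1 / (2 * x) ≤ x / (x + 1 / 2) := by
    rw [le_div_iff₀ (by positivity)]
    have : (1 - 1 / (2 * x)) * (x + 1 / 2) = x - 1 / (4 * x) := by
      field_simp
      ring
    rw [this]
    have : 0 < 1 / (4 * x) := by positivity
    linarith
  refine hx1.trans ?_
  rw [show x + 3 / 2 = (x + 1 / 2) + 1 by ring, Real.Gamma_add_one (by positivity), ← mul_div_assoc,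
    div_le_div_iff₀ (by positivity) (by positivity)]
  calc x * ((x + 1 / 2) * Real.Gamma (x + 1 / 2))
      ≤ x * ((x + 1 / 2) * (√x * Real.Gamma x)) := by gcongr
    _ = _ := by ring

theorem abs_sqrt_four_sub_sub_two_le {t : ℝ} (ht : 0 ≤ t) :
    |√(4 - 5 * t) - 2| ≤ 5 / 2 * t := by
  have h0 := Real.sqrt_nonneg (4 - 5 * t)
  have h2 : √(4 - 5 * t) ≤ 2 := Real.sqrt_le_iff.2 ⟨by norm_num, by linarith⟩
  have hs : 4 - 5 * t ≤ √(4 - 5 * t) ^ 2 := (Real.sqrt_le_iff.1 le_rfl).2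
  rw [abs_le]
  constructor <;> nlinarith

theorem integral_one_sub_pow_mul_sqrt (m j : ℕ) :
    ∫ t in (0 : ℝ)..1, (1 - t) ^ m * (t ^ j * √t) =
      ProbabilityTheory.beta (j + 3 / 2) (m + 1) := by
  rw [← integral_rpow_mul_one_sub_rpow (by positivity) (by positivity)]
  refine intervalIntegral.integral_congr fun t ht => ?_
  rw [Set.uIcc_of_le zero_le_one] at ht
  simp only [add_sub_cancel_right, Real.rpow_natCast]
  rw [pow_mul_sqrt_eq_rpow ht.1, mul_comm]

theorem abs_laplace_integral_sub_le (m : ℕ) :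
    |(∫ t in (0 : ℝ)..1, (1 - t) ^ m * (√t * √(4 - 5 * t))) -
        2 * ProbabilityTheory.beta (3 / 2) (m + 1)| ≤
      5 / 2 * ProbabilityTheory.beta (3 / 2 + 1) (m + 1) := by
  have h0 := integral_one_sub_pow_mul_sqrt m 0
  have h1 := integral_one_sub_pow_mul_sqrt m 1
  simp only [pow_zero, one_mul, Nat.cast_zero, zero_add, pow_one, Nat.cast_one] at h0 h1
  rw [add_comm (3 / 2 : ℝ), ← h0, ← h1, ← intervalIntegral.integral_const_mul,
    ← intervalIntegral.integral_const_mul, ← intervalIntegral.integral_sub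
      (Continuous.intervalIntegrable (by fun_prop) _ _)
      (Continuous.intervalIntegrable (by fun_prop) _ _), ← Real.norm_eq_abs]
  refine intervalIntegral.norm_integral_le_of_norm_le zero_le_one
    (Eventually.of_forall fun t ht => ?_) (Continuous.intervalIntegrable (by fun_prop) _ _)
  have ht1 : 0 ≤ 1 - t := sub_nonneg.2 ht.2
  rw [show (1 - t) ^ m * (√t * √(4 - 5 * t)) - 2 * ((1 - t) ^ m * √t) =
    (1 - t) ^ m * √t * (√(4 - 5 * t) - 2) by ring, Real.norm_eq_abs, abs_mul,
    abs_of_nonneg (by positivity)]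
  calc _ ≤ (1 - t) ^ m * √t * (5 / 2 * t) := by
        gcongr
        exact abs_sqrt_four_sub_sub_two_le ht.1.le
    _ = _ := by ring

theorem abs_A_div_sub_one_le {n : ℕ} (hn : 1 ≤ n) :
    |(A n : ℝ) / ((5 : ℝ) ^ ((n : ℝ) + 1 / 2) / (2 * √(Real.pi * (n : ℝ) ^ 3))) - 1| ≤
      3 * (1 / (n : ℝ)) := by
  obtain ⟨m, rfl⟩ := Nat.exists_eq_add_of_le' hn
  have hI := abs_laplace_integral_sub_le m
  rw [beta_add_one_left (by norm_num) (by positivity), ProbabilityTheory.beta,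
    Gamma_three_halves, add_comm (3 / 2 : ℝ)] at hI
  rw [A_succ_eq_laplace_integral]
  set I := ∫ t in (0 : ℝ)..1, (1 - t) ^ m * (√t * √(4 - 5 * t))
  push_cast at hI ⊢
  set x : ℝ := (m : ℝ) + 1 with hx
  have hx0 : 0 < x := by positivity
  set q := Real.Gamma x / Real.Gamma (x + 3 / 2) with hq
  have hq0 : 0 < q :=
    div_pos (Real.Gamma_pos_of_pos hx0) (Real.Gamma_pos_of_pos (by positivity))
  have hle := Gamma_ratio_le_one hx0
  have hge := one_sub_le_Gamma_ratio hx0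
  rw [← hq] at hle hge
  have hpi : √Real.pi * √Real.pi = Real.pi := Real.mul_self_sqrt Real.pi_pos.le
  have hspi : 0 < √Real.pi := Real.sqrt_pos.2 Real.pi_pos
  have hsx : 0 < √x := Real.sqrt_pos.2 hx0
  have hsqrt : √(Real.pi * x ^ 3) = √Real.pi * (x * √x) := by
    rw [show Real.pi * x ^ 3 = Real.pi * (x ^ 2 * x) by ring, Real.sqrt_mul Real.pi_pos.le,
      Real.sqrt_mul (by positivity), Real.sqrt_sq hx0.le]
  have h5 : (5 : ℝ) ^ (x + 1 / 2) = 5 ^ (m + 1) * √5 := by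
    rw [Real.rpow_add (by norm_num), ← Real.sqrt_eq_rpow, hx, ← Nat.cast_succ, Real.rpow_natCast]
  have hratio : √5 * 5 ^ (m + 1) / (2 * Real.pi) * I /
      ((5 : ℝ) ^ (x + 1 / 2) / (2 * √(Real.pi * x ^ 3))) = x * √x / √Real.pi * I := by
    have := Real.pi_pos
    rw [h5, hsqrt]
    field_simp
    linear_combination I * hpi
  have hdecomp : x * √x / √Real.pi * I - 1 =
      x * √x / √Real.pi * (I - 2 * (√Real.pi / 2 * Real.Gamma x / Real.Gamma (x + 3 / 2))) +
        (x * √x * q - 1) := by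
    rw [hq]
    field_simp
    ring
  have herr : x * √x / √Real.pi * (5 / 2 * (3 / 2 / (x + 3 / 2) *
      (√Real.pi / 2 * Real.Gamma x / Real.Gamma (x + 3 / 2)))) =
      15 / 8 / (x + 3 / 2) * (x * √x * q) := by
    rw [hq]
    field_simp
    ring
  have hfrac : 15 / 8 / (x + 3 / 2) ≤ 15 / 8 / x := by
    gcongr
    linarith
  have hmain : |x * √x * q - 1| ≤ 1 / (2 * x) := by
    have : 0 < 1 / (2 * x) := by positivity
    rw [abs_le]
    constructor <;> linarith
  rw [hratio, hdecomp]
  calc _ ≤ _ := abs_add_le _ _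
    _ ≤ 15 / 8 / (x + 3 / 2) * (x * √x * q) + 1 / (2 * x) := by
      rw [← herr, abs_mul, abs_of_pos (by positivity : 0 < x * √x / √Real.pi)]
      gcongr
    _ ≤ 15 / 8 / x * 1 + 1 / (2 * x) := by gcongr
    _ = 19 / 8 * (1 / x) := by
      field_simp
      norm_num
    _ ≤ 3 * (1 / x) := by gcongr; norm_num

/-- `A_n = (5^{n+1/2}/(2√(πn³)))·(1 + O(1/n))` as `n → ∞`. -/
theorem A_asymptotics :
    (fun n : ℕ =>
        (A n : ℝ) / ((5 : ℝ) ^ ((n : ℝ) + 1 / 2) / (2 * Real.sqrt (Real.pi * (n : ℝ) ^ 3)))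
          - 1)
      =O[atTop] (fun n : ℕ => 1 / (n : ℝ)) := by
  refine IsBigO.of_bound 3 ?_
  filter_upwards [eventually_ge_atTop 1] with n hn
  rw [Real.norm_eq_abs, Real.norm_of_nonneg (by positivity)]
  exact abs_A_div_sub_one_le hn
end

section
/- For n ≥ 1 let E_n = ( Σ_{k=2}^{n+1} k·A_{n,k} ) / A_n, the expected number of vertices of a uniformly random rooted plane multi-edge tree with n edges. Then E_n = (4/5)·n + 9/10 + O(1/n) as n → ∞. -/
open Filter Asymptotics

/-- `E_n`, the expected number of vertices of a uniformly random rooted plane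
multi-edge tree with `n` edges. -/
noncomputable def Evert (n : ℕ) : ℚ := (∑ k ∈ Finset.Icc 2 (n + 1), (k : ℚ) * Ank n k) / A n

/-- `∑ i ≤ m, f i * C(m, i)`, the binomial transform of `f`. -/
def binomialTransform (f : ℕ → ℚ) (m : ℕ) : ℚ :=
  ∑ i ∈ Finset.range (m + 1), (m.choose i : ℚ) * f i

theorem binomialTransform_succ (f : ℕ → ℚ) (m : ℕ) :
    binomialTransform f (m + 1) =
      binomialTransform f m + binomialTransform (fun i => f (i + 1)) m :=
  Finset.sum_choose_succ_mul (fun i _ => f i) m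

theorem sum_choose_mul_sub_mul_shift (f : ℕ → ℚ) (m : ℕ) :
    ∑ i ∈ Finset.range (m + 1), (m.choose i : ℚ) * ((m - i) * f (i + 1)) =
      binomialTransform (fun i => i * f i) m := by
  rw [binomialTransform, Finset.sum_range_succ, Finset.sum_range_succ']
  simp only [sub_self, zero_mul, mul_zero, add_zero, Nat.cast_zero]
  refine Finset.sum_congr rfl fun i hi => ?_
  have hle : i ≤ m := (Finset.mem_range.mp hi).le
  have h : (m.choose (i + 1) : ℚ) * (i + 1) = m.choose i * (m - i) := by
    have := Nat.choose_succ_right_eq m i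
    rw [← Nat.cast_sub hle]
    exact_mod_cast this
  push_cast
  linear_combination -f (i + 1) * h

/-- The Catalan number `C_{i+1}`, as a rational number. -/
def catalanSucc (i : ℕ) : ℚ := (i + 1).centralBinom / (i + 2)

theorem add_two_mul_catalanSucc (i : ℕ) :
    ((i : ℚ) + 2) * catalanSucc i = (i + 1).centralBinom :=
  mul_div_cancel₀ _ (by positivity)

theorem add_three_mul_catalanSucc_succ (i : ℕ) :
    ((i : ℚ) + 3) * catalanSucc (i + 1) = 2 * (2 * i + 3) * catalanSucc i := by
  have h : ((i : ℚ) + 2) * (i + 2).centralBinom = 2 * (2 * i + 3) * (i + 1).centralBinom := by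
    have := Nat.succ_mul_centralBinom_succ (i + 1)
    have h' : (((i + 1 + 1) * (i + 1 + 1).centralBinom : ℕ) : ℚ) =
        ((2 * (2 * (i + 1) + 1) * (i + 1).centralBinom : ℕ) : ℚ) := congrArg _ this
    push_cast at h'
    linear_combination h'
  have h1 := add_two_mul_catalanSucc i
  have h2 := add_two_mul_catalanSucc (i + 1)
  push_cast at h2
  have hi : (i : ℚ) + 2 ≠ 0 := by positivity
  apply mul_left_cancel₀ hi
  linear_combination (↑i + 2) * h2 + h - 2 * (2 * i + 3) * h1

theorem Ank_add_two (m i : ℕ) :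
    Ank (m + 1) (i + 2) = m.choose i * catalanSucc i := by
  have h : 2 * (i + 2) - 2 = 2 * (i + 1) := by omega
  simp only [Ank, catalanSucc, Nat.centralBinom, h, Nat.add_sub_cancel,
    show i + 2 - 1 = i + 1 from rfl]
  push_cast
  ring

theorem sum_Icc_two_eq_sum_range (f : ℕ → ℚ) (m : ℕ) :
    ∑ k ∈ Finset.Icc 2 (m + 1 + 1), f k = ∑ i ∈ Finset.range (m + 1), f (i + 2) := by
  rw [Finset.range_eq_Ico, Finset.sum_Ico_add' f 0 (m + 1) 2]
  rfl

theorem A_succ (m : ℕ) : A (m + 1) = binomialTransform catalanSucc m := by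
  rw [A, sum_Icc_two_eq_sum_range]
  exact Finset.sum_congr rfl fun i _ => Ank_add_two m i

/-- The total number of vertices of all rooted plane multi-edge trees with `n` edges. -/
noncomputable def totalVertices (n : ℕ) : ℚ := ∑ k ∈ Finset.Icc 2 (n + 1), (k : ℚ) * Ank n k

theorem totalVertices_succ (m : ℕ) :
    totalVertices (m + 1) = binomialTransform (fun i => (i + 2) * catalanSucc i) m := by
  rw [totalVertices, sum_Icc_two_eq_sum_range]
  refine Finset.sum_congr rfl fun i _ => ?_
  rw [Ank_add_two]
  push_cast
  ring

theorem totalVertices_rec (m : ℕ) :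
    totalVertices (m + 2) = 5 * totalVertices (m + 1) - 2 * A (m + 1) := by
  rw [totalVertices_succ, totalVertices_succ, A_succ, binomialTransform_succ]
  simp only [binomialTransform, Finset.mul_sum, ← Finset.sum_add_distrib,
    ← Finset.sum_sub_distrib]
  refine Finset.sum_congr rfl fun i _ => ?_
  push_cast
  linear_combination (m.choose i : ℚ) * add_three_mul_catalanSucc_succ i

theorem A_rec (m : ℕ) :
    ((m : ℚ) + 3) * A (m + 2) = 5 * totalVertices (m + 1) + (m - 1) * A (m + 1) := by
  have h : ((m : ℚ) + 3) * binomialTransform (fun i => catalanSucc (i + 1)) m =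
      binomialTransform (fun i => 2 * (2 * i + 3) * catalanSucc i) m +
        binomialTransform (fun i => i * catalanSucc i) m := by
    rw [← sum_choose_mul_sub_mul_shift]
    simp only [binomialTransform, Finset.mul_sum, ← Finset.sum_add_distrib]
    refine Finset.sum_congr rfl fun i _ => ?_
    linear_combination (m.choose i : ℚ) * add_three_mul_catalanSucc_succ i
  have h' : binomialTransform (fun i => 2 * (2 * i + 3) * catalanSucc i) m +
      binomialTransform (fun i => i * catalanSucc i) m =
        5 * binomialTransform (fun i => (i + 2) * catalanSucc i) m -
          4 * binomialTransform catalanSucc m := by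
    simp only [binomialTransform, Finset.mul_sum, ← Finset.sum_add_distrib,
      ← Finset.sum_sub_distrib]
    exact Finset.sum_congr rfl fun i _ => by ring
  rw [totalVertices_succ, A_succ, A_succ, binomialTransform_succ]
  linear_combination h + h'

theorem A_succ_pos (m : ℕ) : 0 < A (m + 1) := by
  rw [A_succ]
  refine Finset.sum_pos (fun i hi => ?_) Finset.nonempty_range_add_one
  have h1 : 0 < m.choose i := Nat.choose_pos (Nat.lt_succ_iff.mp (Finset.mem_range.mp hi))
  have h2 := Nat.centralBinom_pos (i + 1)
  unfold catalanSucc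
  positivity

theorem Evert_one : Evert 1 = 2 := by
  have hA : A 1 = 1 := by simp [A, Ank]
  simp [Evert, hA, Ank]

theorem Evert_rec (m : ℕ) :
    Evert (m + 2) * (5 * Evert (m + 1) + m - 1) = (m + 3) * (5 * Evert (m + 1) - 2) := by
  have hA := (A_succ_pos m).ne'
  have hA' := (A_succ_pos (m + 1)).ne'
  have h1 : Evert (m + 1) * A (m + 1) = totalVertices (m + 1) := div_mul_cancel₀ _ hA
  have h2 : Evert (m + 2) * A (m + 2) = totalVertices (m + 2) := div_mul_cancel₀ _ hA'
  apply mul_right_cancel₀ hA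
  linear_combination (5 * Evert (m + 2) - 5 * (m + 3)) * h1 + (m + 3) * h2 -
    Evert (m + 2) * A_rec m + (m + 3) * totalVertices_rec m

theorem Evert_succ_bounds (m : ℕ) :
    0 ≤ Evert (m + 1) - (4 / 5 * (m + 1) + 9 / 10) ∧
      (Evert (m + 1) - (4 / 5 * (m + 1) + 9 / 10)) * (m + 1) ≤ 1 := by
  induction m with
  | zero => norm_num [Evert_one]
  | succ m ih =>
    obtain ⟨h0, h1⟩ := ih
    have hrec := Evert_rec m
    push_cast
    rw [show m + 1 + 1 = m + 2 from rfl]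
    set e := Evert (m + 1) - (4 / 5 * (m + 1) + 9 / 10) with he
    set e' := Evert (m + 2) - (4 / 5 * ((m : ℚ) + 1 + 1) + 9 / 10) with he'
    have hm : (0 : ℚ) ≤ m := m.cast_nonneg
    have hstep : e' * (5 * m + 15 / 2 + 5 * e) = 3 / 4 + e * (m + 5 / 2) := by
      rw [he, he']
      linear_combination hrec
    have hden : 0 < 5 * (m : ℚ) + 15 / 2 + 5 * e := by positivity
    have he'_nonneg : 0 ≤ e' :=
      nonneg_of_mul_nonneg_left (hstep ▸ by positivity) hden
    refine ⟨he'_nonneg, le_of_mul_le_mul_right ?_ hden⟩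
    have he_le : e ≤ 1 := by nlinarith
    calc e' * (m + 1 + 1) * (5 * m + 15 / 2 + 5 * e)
        = (3 / 4 + e * (m + 5 / 2)) * (m + 2) := by linear_combination (m + 2) * hstep
      _ ≤ 1 * (5 * m + 15 / 2 + 5 * e) := by nlinarith

/-- `E_n = (4/5)n + 9/10 + O(1/n)` as `n → ∞`. -/
theorem expected_vertices :
    (fun n : ℕ => (Evert n : ℝ) - ((4 / 5) * (n : ℝ) + 9 / 10))
      =O[atTop] (fun n : ℕ => 1 / (n : ℝ)) := by
  refine IsBigO.of_bound 1 ?_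
  filter_upwards [eventually_ge_atTop 1] with n hn
  obtain ⟨m, rfl⟩ := Nat.exists_eq_add_of_le' hn
  obtain ⟨h0, h1⟩ := Evert_succ_bounds m
  have h0' : (0 : ℝ) ≤ Evert (m + 1) - (4 / 5 * (m + 1) + 9 / 10) := by
    simpa using (Rat.cast_le (K := ℝ)).2 h0
  have h1' : ((Evert (m + 1) : ℝ) - (4 / 5 * (m + 1) + 9 / 10)) * (m + 1) ≤ 1 := by
    simpa using (Rat.cast_le (K := ℝ)).2 h1
  have hm : (0 : ℝ) < m + 1 := by positivity
  push_cast
  rw [one_mul, Real.norm_of_nonneg h0', Real.norm_of_nonneg (by positivity), le_div_iff₀ hm]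
  exact h1'
end

section
/- For n ≥ 1 and v ∈ ℝ let P_n(v) = ( Σ_{k : 2 ≤ k ≤ n+1, k ≤ (4/5)n + (2/5)√n·v} A_{n,k} ) / A_n, the distribution function of the normalized number of vertices of a uniformly random rooted plane multi-edge tree with n edges. Then sup_{v ∈ ℝ} | P_n(v) − (1/√(2π))·∫_{−∞}^{v} e^{−t²/2} dt | = O(1/√n) as n → ∞. -/
open Filter MeasureTheory

/-- `P_n(v)`, the distribution function of the normalized number of vertices of a
uniformly random rooted plane multi-edge tree with `n` edges. -/
noncomputable def Pdf (n : ℕ) (v : ℝ) : ℝ :=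
  (((∑ k ∈ (Finset.Icc 2 (n + 1)).filter
        (fun k : ℕ => (k : ℝ) ≤ (4 / 5) * (n : ℝ) + (2 / 5) * Real.sqrt n * v),
      Ank n k) / A n : ℚ) : ℝ)

theorem antitoneOn_exp_neg_mul_sq {c : ℝ} (hc : 0 ≤ c) :
    AntitoneOn (fun t : ℝ => Real.exp (-c * t ^ 2)) (Set.Ici 0) := by
  intro x hx y _ hxy
  have hx0 : (0 : ℝ) ≤ x := hx
  have : x ^ 2 ≤ y ^ 2 := by gcongr
  exact Real.exp_le_exp.2 (by nlinarith)

theorem abs_sum_sub_integral_exp_neg_mul_sq_le {c : ℝ} (hc : 0 ≤ c) (J : ℕ) :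
    |∑ j ∈ Finset.range J, Real.exp (-c * (j : ℝ) ^ 2)
      - ∫ t in (0 : ℝ)..J, Real.exp (-c * t ^ 2)| ≤ 1 := by
  have hanti : AntitoneOn (fun t : ℝ => Real.exp (-c * t ^ 2)) (Set.Icc 0 (0 + (J : ℝ))) :=
    (antitoneOn_exp_neg_mul_sq hc).mono fun x hx => hx.1
  have h1 := hanti.integral_le_sum
  have h2 := hanti.sum_le_integral
  have h3 := Finset.sum_range_succ (fun j : ℕ => Real.exp (-c * (j : ℝ) ^ 2)) J
  have h4 := Finset.sum_range_succ' (fun j : ℕ => Real.exp (-c * (j : ℝ) ^ 2)) J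
  have h5 : 0 < Real.exp (-c * (J : ℝ) ^ 2) := Real.exp_pos _
  simp only [zero_add] at h1 h2
  norm_num at h4
  push_cast at h2
  rw [abs_le]
  constructor <;> simp only [neg_mul] at * <;> linarith

theorem integral_exp_neg_mul_sq_le {c : ℝ} (hc : 0 < c) {x : ℝ} (hx : 0 ≤ x) :
    ∫ t in (0 : ℝ)..x, Real.exp (-c * t ^ 2) ≤ Real.sqrt (Real.pi / c) / 2 := by
  rw [← integral_gaussian_Ioi c, intervalIntegral.integral_of_le hx]
  exact setIntegral_mono_set (integrable_exp_neg_mul_sq hc).integrableOn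
    (Eventually.of_forall fun t => (Real.exp_pos _).le)
    (Set.Ioc_subset_Ioi_self).eventuallyLE

theorem add_pow_three_le_mul_exp {a : ℝ} (ha : 0 < a) (x : ℝ) :
    x + x ^ 3 ≤ (2 + 64 / a ^ 2) * Real.exp (a * x ^ 2 / 4) := by
  have h1 : 1 ≤ Real.exp (a * x ^ 2 / 4) := Real.one_le_exp (by positivity)
  have h2 := Real.quadratic_le_exp_of_nonneg (x := a * x ^ 2 / 4) (by positivity)
  have h3 : x ^ 4 ≤ 32 / a ^ 2 * Real.exp (a * x ^ 2 / 4) := by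
    have : x ^ 4 = 32 / a ^ 2 * ((a * x ^ 2 / 4) ^ 2 / 2) := by field_simp; ring
    rw [this]
    gcongr
    nlinarith [show 0 ≤ a * x ^ 2 by positivity]
  have h4 : x + x ^ 3 ≤ 2 + 2 * x ^ 4 := by
    nlinarith [sq_nonneg (x - 1), sq_nonneg (x ^ 2 - 1), sq_nonneg (x ^ 2 - x), sq_nonneg x]
  have h5 : 64 / a ^ 2 = 2 * (32 / a ^ 2) := by ring
  rw [h5]
  linarith

/-- A sequence whose successive ratios are close to those of a Gaussian is close to it. -/
theorem abs_sub_exp_le_of_ratio {a b K n : ℝ} (hn : 0 < n) (ha : 0 < a) (hab : a ≤ b)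
    (hK : 2 * a ≤ K) {w r : ℕ → ℝ} (hw0 : w 0 = 1) (hw : ∀ j, w (j + 1) = r j * w j)
    (hr0 : ∀ j, 0 ≤ r j) (hr : ∀ j : ℕ, r j ≤ Real.exp ((K - a * (2 * j + 1)) / n))
    (hrs : ∀ j : ℕ, |r j - Real.exp (-(b / n) * (2 * j + 1))| ≤
      K * (1 / n + (j : ℝ) ^ 2 / n ^ 2)) (j : ℕ) :
    |w j - Real.exp (-(b / n) * (j : ℝ) ^ 2)| ≤
      K * (j * (1 / n + (j : ℝ) ^ 2 / n ^ 2)) * Real.exp ((K * j - a * (j : ℝ) ^ 2) / n) := by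
  have hK0 : 0 < K := by linarith
  induction j with
  | zero => simp [hw0]
  | succ j ih =>
    set s := Real.exp (-(b / n) * (2 * j + 1)) with hs
    set g := Real.exp (-(b / n) * (j : ℝ) ^ 2) with hg
    have hg1 : Real.exp (-(b / n) * ((j + 1 : ℕ) : ℝ) ^ 2) = s * g := by
      rw [hs, hg, ← Real.exp_add]; congr 1; push_cast; ring
    set e := Real.exp ((K * (j + 1 : ℕ) - a * ((j + 1 : ℕ) : ℝ) ^ 2) / n) with he
    have he1 : Real.exp ((K - a * (2 * j + 1)) / n) *
        Real.exp ((K * j - a * (j : ℝ) ^ 2) / n) = e := by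
      rw [he, ← Real.exp_add]; congr 1; push_cast; ring
    have hge : g ≤ e := by
      apply Real.exp_le_exp.2
      rw [neg_mul, div_mul_eq_mul_div, ← neg_div]
      gcongr
      push_cast
      have hj : (0 : ℝ) ≤ j := by positivity
      nlinarith [mul_nonneg (sub_nonneg.2 hab) (sq_nonneg (j : ℝ)),
        mul_nonneg (sub_nonneg.2 hK) hj]
    have hq : 0 ≤ K * (1 / n + (j : ℝ) ^ 2 / n ^ 2) := by positivity
    have hg0 : 0 < g := Real.exp_pos _
    calc |w (j + 1) - Real.exp (-(b / n) * ((j + 1 : ℕ) : ℝ) ^ 2)|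
        = |r j * (w j - g) + (r j - s) * g| := by rw [hg1, hw]; congr 1; ring
      _ ≤ r j * |w j - g| + |r j - s| * g := by
        refine (abs_add_le _ _).trans_eq ?_
        rw [abs_mul, abs_mul, abs_of_nonneg (hr0 j), abs_of_pos hg0]
      _ ≤ Real.exp ((K - a * (2 * j + 1)) / n) *
            (K * (j * (1 / n + (j : ℝ) ^ 2 / n ^ 2)) *
              Real.exp ((K * j - a * (j : ℝ) ^ 2) / n)) +
            K * (1 / n + (j : ℝ) ^ 2 / n ^ 2) * e := by
        gcongr
        · exact hr j
        · exact hrs j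
      _ = K * ((j + 1 : ℕ) * (1 / n + (j : ℝ) ^ 2 / n ^ 2)) * e := by
        rw [← he1]; push_cast; ring
      _ ≤ _ := by
        gcongr
        simp

theorem exists_abs_sum_sub_integral_le {a b K : ℝ} (ha : 0 < a) (hab : a ≤ b)
    (hK : 2 * a ≤ K) :
    ∃ C : ℝ, ∀ n : ℝ, 1 ≤ n → ∀ w r : ℕ → ℝ, w 0 = 1 → (∀ j, w (j + 1) = r j * w j) →
      (∀ j, 0 ≤ r j) → (∀ j : ℕ, r j ≤ Real.exp ((K - a * (2 * j + 1)) / n)) →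
      (∀ j : ℕ, |r j - Real.exp (-(b / n) * (2 * j + 1))| ≤
        K * (1 / n + (j : ℝ) ^ 2 / n ^ 2)) →
      ∀ J : ℕ, |∑ j ∈ Finset.range J, w j
        - ∫ t in (0 : ℝ)..J, Real.exp (-(b / n) * t ^ 2)| ≤ C := by
  have hK0 : 0 < K := by linarith
  set D := K * (2 + 64 / a ^ 2) * Real.exp (K ^ 2 / (2 * a)) with hD
  have hD0 : 0 < D := by positivity
  refine ⟨D * (Real.sqrt (Real.pi / (a / 4)) / 2 + 1) + 1, ?_⟩
  intro n hn w r hw0 hw hr0 hr hrs J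
  have hn0 : 0 < n := by linarith
  have hb : 0 < b := by linarith
  have hsn : 0 < Real.sqrt n := Real.sqrt_pos.2 hn0
  have hsq : Real.sqrt n ^ 2 = n := Real.sq_sqrt hn0.le
  have hterm : ∀ j : ℕ, |w j - Real.exp (-(b / n) * (j : ℝ) ^ 2)| ≤
      D / Real.sqrt n * Real.exp (-(a / 4 / n) * (j : ℝ) ^ 2) := by
    intro j
    refine (abs_sub_exp_le_of_ratio hn0 ha hab hK hw0 hw hr0 hr hrs j).trans ?_
    have hx := add_pow_three_le_mul_exp ha (j / Real.sqrt n)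
    have hx2 : (j / Real.sqrt n) ^ 2 = (j : ℝ) ^ 2 / n := by rw [div_pow, hsq]
    have h1 : j * (1 / n + (j : ℝ) ^ 2 / n ^ 2) =
        1 / Real.sqrt n * (j / Real.sqrt n + (j / Real.sqrt n) ^ 3) := by
      have : n ^ 2 = Real.sqrt n ^ 4 := by rw [← hsq]; simp [← pow_mul]
      rw [this]
      nth_rewrite 1 [← hsq]
      field_simp
    have h2 : Real.exp ((K * j - a * (j : ℝ) ^ 2) / n) ≤
        Real.exp (K ^ 2 / (2 * a)) * Real.exp (-(a / 2 / n) * (j : ℝ) ^ 2) := by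
      rw [← Real.exp_add]
      apply Real.exp_le_exp.2
      have h3 : K * j - a * (j : ℝ) ^ 2 ≤ K ^ 2 / (2 * a) - a / 2 * (j : ℝ) ^ 2 := by
        have : K ^ 2 / (2 * a) - a / 2 * (j : ℝ) ^ 2 - (K * j - a * (j : ℝ) ^ 2) =
          (K - a * j) ^ 2 / (2 * a) := by field_simp; ring
        have h4 : 0 ≤ (K - a * j) ^ 2 / (2 * a) := by positivity
        linarith
      calc (K * j - a * (j : ℝ) ^ 2) / n
          ≤ (K ^ 2 / (2 * a) - a / 2 * (j : ℝ) ^ 2) / n := by gcongr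
        _ = K ^ 2 / (2 * a) / n + -(a / 2 / n) * (j : ℝ) ^ 2 := by ring
        _ ≤ _ := by
          have : K ^ 2 / (2 * a) / n ≤ K ^ 2 / (2 * a) := div_le_self (by positivity) hn
          linarith
    have h5 : Real.exp (a * (j / Real.sqrt n) ^ 2 / 4) * Real.exp (-(a / 2 / n) * (j : ℝ) ^ 2)
        = Real.exp (-(a / 4 / n) * (j : ℝ) ^ 2) := by
      rw [hx2, ← Real.exp_add]; congr 1; ring
    calc _ ≤ K * (1 / Real.sqrt n * ((2 + 64 / a ^ 2) *
            Real.exp (a * (j / Real.sqrt n) ^ 2 / 4))) *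
          (Real.exp (K ^ 2 / (2 * a)) * Real.exp (-(a / 2 / n) * (j : ℝ) ^ 2)) := by
          rw [h1]; gcongr
      _ = _ := by rw [← h5, hD]; ring
  have hsum : ∑ j ∈ Finset.range J, Real.exp (-(a / 4 / n) * (j : ℝ) ^ 2) ≤
      (Real.sqrt (Real.pi / (a / 4)) / 2 + 1) * Real.sqrt n := by
    have hc : 0 < a / 4 / n := by positivity
    have h1 := (abs_le.1 (abs_sum_sub_integral_exp_neg_mul_sq_le hc.le J)).2
    have h2 := integral_exp_neg_mul_sq_le hc (x := J) (by positivity)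
    have h3 : Real.sqrt (Real.pi / (a / 4 / n)) =
        Real.sqrt (Real.pi / (a / 4)) * Real.sqrt n := by
      rw [← Real.sqrt_mul (by positivity)]; congr 1; field_simp
    have h4 : 1 ≤ Real.sqrt n := Real.one_le_sqrt.2 hn
    rw [h3] at h2
    linarith
  have hdiff : |∑ j ∈ Finset.range J, w j -
      ∑ j ∈ Finset.range J, Real.exp (-(b / n) * (j : ℝ) ^ 2)| ≤
      D * (Real.sqrt (Real.pi / (a / 4)) / 2 + 1) := by
    rw [← Finset.sum_sub_distrib]
    calc _ ≤ ∑ j ∈ Finset.range J, |w j - Real.exp (-(b / n) * (j : ℝ) ^ 2)| :=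
          Finset.abs_sum_le_sum_abs _ _
      _ ≤ ∑ j ∈ Finset.range J, D / Real.sqrt n * Real.exp (-(a / 4 / n) * (j : ℝ) ^ 2) :=
          Finset.sum_le_sum fun j _ => hterm j
      _ = D / Real.sqrt n * ∑ j ∈ Finset.range J, Real.exp (-(a / 4 / n) * (j : ℝ) ^ 2) := by
          rw [Finset.mul_sum]
      _ ≤ D / Real.sqrt n * ((Real.sqrt (Real.pi / (a / 4)) / 2 + 1) * Real.sqrt n) := by gcongr
      _ = _ := by field_simp
  have hint := abs_sum_sub_integral_exp_neg_mul_sq_le (c := b / n) (by positivity) J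
  exact (abs_sub_le _ _ _).trans (add_le_add hdiff hint)

theorem abs_exp_neg_sub_le {x : ℝ} (hx : 0 ≤ x) : |Real.exp (-x) - (1 - x)| ≤ x ^ 2 := by
  have h1 := Real.add_one_le_exp (-x)
  have h2 := Real.add_one_le_exp x
  have h3 : Real.exp (-x) ≤ 1 / (1 + x) := by
    rw [Real.exp_neg, ← one_div]
    exact one_div_le_one_div_of_le (by linarith) (by linarith)
  have h4 : 1 / (1 + x) ≤ 1 - x + x ^ 2 := by
    rw [div_le_iff₀ (by linarith)]
    nlinarith [pow_nonneg hx 3]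
  rw [abs_le]
  constructor <;> nlinarith [sq_nonneg x]

theorem abs_sub_exp_le_of_abs_sub_linear_le {n j r K : ℝ} (hn : 1 ≤ n) (hj : 0 ≤ j)
    (h : |r - (1 - 25 * j / (4 * n))| ≤ K * (1 / n + j ^ 2 / n ^ 2)) :
    |r - Real.exp (-(25 / 8 / n) * (2 * j + 1))| ≤ (K + 100) * (1 / n + j ^ 2 / n ^ 2) := by
  have hn0 : 0 < n := by linarith
  have h1 := abs_exp_neg_sub_le (x := 25 / 8 / n * (2 * j + 1)) (by positivity)
  have h2 : (25 / 8 / n * (2 * j + 1)) ^ 2 ≤ 90 * (1 / n + j ^ 2 / n ^ 2) := by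
    have e : 90 * (1 / n + j ^ 2 / n ^ 2) - (25 / 8 / n * (2 * j + 1)) ^ 2 =
        (90 * (n + j ^ 2) - (25 / 8 * (2 * j + 1)) ^ 2) / n ^ 2 := by field_simp
    have : 0 ≤ (90 * (n + j ^ 2) - (25 / 8 * (2 * j + 1)) ^ 2) / n ^ 2 := by
      apply div_nonneg _ (by positivity)
      nlinarith [sq_nonneg (j - 1)]
    linarith
  have h3 : 25 / 8 / n ≤ 10 * (1 / n + j ^ 2 / n ^ 2) := by
    have : 0 ≤ j ^ 2 / n ^ 2 := by positivity
    have e : 25 / 8 / n = 25 / 8 * (1 / n) := by ring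
    have : 0 < 1 / n := by positivity
    linarith
  have h4 : 1 - 25 / 8 / n * (2 * j + 1) = 1 - 25 * j / (4 * n) - 25 / 8 / n := by
    field_simp; ring
  have h5 : 0 < 25 / 8 / n := by positivity
  rw [h4] at h1
  rw [neg_mul]
  rw [abs_le] at *
  constructor <;> linarith

theorem ratio_right_le {n k j e : ℝ} (hn : 10 ≤ n) (hj : 0 ≤ j) (he : 0 ≤ e)
    (hk : 5 * k = 4 * n + 5 * j + e) (hkn : k ≤ n + 1) :
    2 * (2 * k - 1) * (n + 1 - k) / ((k + 1) * (k - 1)) ≤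
      1 + (1000 - 5 / 8 * (2 * j + 1)) / n := by
  have hk8 : 8 ≤ k := by linarith
  have hn0 : 0 < n := by linarith
  have h0 : 0 < (k + 1) * (k - 1) := by nlinarith
  have h1 : n * (2 * (2 * k - 1) * (n + 1 - k) - (k + 1) * (k - 1)) ≤
      (1000 - 5 / 8 * (2 * j + 1)) * ((k + 1) * (k - 1)) := by
    have e1 : 2 * (2 * k - 1) * (n + 1 - k) - (k + 1) * (k - 1) =
      k * (6 - e - 5 * j) - 2 * n - 1 := by
      have : e = 5 * k - 4 * n - 5 * j := by linarith
      rw [this]; ring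
    rw [e1]
    have a1 : n * (k * (6 - e - 5 * j) - 2 * n - 1) ≤ 6 * (n * k) - 5 * j * (n * k) := by
      nlinarith [mul_nonneg (mul_nonneg hn0.le (by linarith : (0:ℝ) ≤ k)) he]
    have a2 : n * k ≤ 2 * ((k + 1) * (k - 1)) := by nlinarith
    have a3 : (k + 1) * (k - 1) ≤ 4 * (n * k) := by nlinarith
    nlinarith [mul_le_mul_of_nonneg_left a3 hj]
  have h2 : 2 * (2 * k - 1) * (n + 1 - k) / ((k + 1) * (k - 1)) - 1 =
      (2 * (2 * k - 1) * (n + 1 - k) - (k + 1) * (k - 1)) / ((k + 1) * (k - 1)) :=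
    div_sub_one h0.ne'
  have h3 : (2 * (2 * k - 1) * (n + 1 - k) - (k + 1) * (k - 1)) / ((k + 1) * (k - 1)) ≤
      (1000 - 5 / 8 * (2 * j + 1)) / n := by
    rw [div_le_div_iff₀ h0 hn0]; linarith
  linarith

theorem abs_ratio_right_sub_le {n k j e : ℝ} (hn : 10 ≤ n) (hj : 0 ≤ j) (he : 0 ≤ e)
    (he4 : e ≤ 4) (hk : 5 * k = 4 * n + 5 * j + e) (hkn : k ≤ n + 1) :
    |2 * (2 * k - 1) * (n + 1 - k) / ((k + 1) * (k - 1)) - (1 - 25 * j / (4 * n))| ≤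
      900 * (1 / n + j ^ 2 / n ^ 2) := by
  have hk8 : 8 ≤ k := by linarith
  have hn0 : 0 < n := by linarith
  have h0 : k ^ 2 / 2 ≤ (k + 1) * (k - 1) := by nlinarith
  have h00 : 0 < (k + 1) * (k - 1) := by nlinarith
  have hd : 0 < (k + 1) * (k - 1) * (4 * n ^ 2) := by positivity
  have e1 : 2 * (2 * k - 1) * (n + 1 - k) / ((k + 1) * (k - 1)) - (1 - 25 * j / (4 * n)) =
      ((4 * n ^ 2) * (k * (6 - e) - 2 * n - 1) + 5 * n * j * (k * (5 * j + e) - 5)) /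
        ((k + 1) * (k - 1) * (4 * n ^ 2)) := by
    have : e = 5 * k - 4 * n - 5 * j := by linarith
    have hk1 : k - 1 ≠ 0 := by linarith
    have hk2 : k + 1 ≠ 0 := by linarith
    rw [this]; field_simp; ring
  have e2 : 900 * (1 / n + j ^ 2 / n ^ 2) = 900 * (n + j ^ 2) / n ^ 2 := by field_simp
  rw [e1, e2, abs_div, abs_of_pos hd, div_le_div_iff₀ hd (by positivity)]
  have a1 : |(4 * n ^ 2) * (k * (6 - e) - 2 * n - 1) + 5 * n * j * (k * (5 * j + e) - 5)| ≤
      4 * n ^ 2 * (10 * k) + 5 * n * j * (k * (5 * j + 5)) := by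
    refine (abs_add_le _ _).trans ?_
    rw [abs_mul (4 * n ^ 2), abs_mul (5 * n * j), abs_of_pos (by positivity : 0 < 4 * n ^ 2),
      abs_of_nonneg (by positivity : 0 ≤ 5 * n * j)]
    gcongr
    · rw [abs_le]; constructor <;> nlinarith
    · rw [abs_le]; constructor <;> nlinarith [mul_nonneg (by linarith : 0 ≤ k) hj]
  have a2 : n * k ≤ 5 / 2 * ((k + 1) * (k - 1)) := by nlinarith
  have a3 : 4 * n ^ 2 * (10 * k) + 5 * n * j * (k * (5 * j + 5)) ≤
      (n * k) * (60 * n + 25 * j ^ 2) := by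
    have : (n * k) * (60 * n + 25 * j ^ 2) - (4 * n ^ 2 * (10 * k) +
        5 * n * j * (k * (5 * j + 5))) = (n * k) * (20 * n - 25 * j) := by ring
    have : 0 ≤ (n * k) * (20 * n - 25 * j) := by
      apply mul_nonneg (by positivity); linarith
    linarith
  calc _ ≤ (4 * n ^ 2 * (10 * k) + 5 * n * j * (k * (5 * j + 5))) * n ^ 2 := by gcongr
    _ ≤ (n * k) * (60 * n + 25 * j ^ 2) * n ^ 2 := by gcongr
    _ ≤ 5 / 2 * ((k + 1) * (k - 1)) * (60 * n + 25 * j ^ 2) * n ^ 2 := by gcongr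
    _ = ((k + 1) * (k - 1)) * n ^ 2 * (150 * n + 125 / 2 * j ^ 2) := by ring
    _ ≤ ((k + 1) * (k - 1)) * n ^ 2 * (3600 * n + 3600 * j ^ 2) := by gcongr <;> norm_num
    _ = _ := by ring

theorem ratio_left_le {n k j e : ℝ} (hn : 10 ≤ n) (hj : 0 ≤ j) (he4 : e ≤ 4)
    (hk : 5 * k = 4 * n + e - 5 * j - 5) (hk2 : 2 ≤ k) :
    (k + 1) * (k - 1) / (2 * (2 * k - 1) * (n + 1 - k)) ≤
      1 + (1000 - 5 / 8 * (2 * j + 1)) / n := by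
  have hn0 : 0 < n := by linarith
  have hkn : 0 < n + 1 - k := by linarith
  have h1 : (k + 1) * (k - 1) / (2 * (2 * k - 1) * (n + 1 - k)) ≤
      (2 * k + 1) / (8 * (n + 1 - k)) := by
    rw [div_le_div_iff₀ (by apply mul_pos <;> linarith) (by linarith)]
    nlinarith
  have h2 : (2 * k + 1) / (8 * (n + 1 - k)) ≤ 1 - (5 / 8 * (2 * j + 1)) / n := by
    have : 1 - (5 / 8 * (2 * j + 1)) / n = (n - 5 / 8 * (2 * j + 1)) / n := by field_simp
    rw [this, div_le_div_iff₀ (by linarith) hn0]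
    nlinarith
  have h3 : (1000 - 5 / 8 * (2 * j + 1)) / n = 1000 / n - 5 / 8 * (2 * j + 1) / n := by ring
  have : 0 < 1000 / n := by positivity
  linarith

theorem abs_ratio_left_sub_le {n k j e : ℝ} (hn : 10 ≤ n) (hj : 0 ≤ j) (he : 0 ≤ e)
    (he4 : e ≤ 4) (hk : 5 * k = 4 * n + e - 5 * j - 5) (hk2 : 2 ≤ k) :
    |(k + 1) * (k - 1) / (2 * (2 * k - 1) * (n + 1 - k)) - (1 - 25 * j / (4 * n))| ≤
      900 * (1 / n + j ^ 2 / n ^ 2) := by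
  have hn0 : 0 < n := by linarith
  have hkn : 0 < n + 1 - k := by linarith
  have e2 : 900 * (1 / n + j ^ 2 / n ^ 2) = 900 * (n + j ^ 2) / n ^ 2 := by field_simp
  obtain ⟨c, hc⟩ : ∃ c, c = 1 - 3 / (2 * k - 1) := ⟨_, rfl⟩
  have h3 : 0 ≤ 3 / (2 * k - 1) := div_nonneg (by norm_num) (by linarith)
  have h4 : 3 / (2 * k - 1) ≤ 1 := by rw [div_le_one (by linarith)]; linarith
  have hk1 : 2 * k - 1 ≠ 0 := by linarith
  have h1 : (k + 1) * (k - 1) / (2 * (2 * k - 1) * (n + 1 - k)) =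
      (2 * k + c) / (8 * (n + 1 - k)) := by
    have hc' : c * (2 * k - 1) = 2 * k - 4 := by
      rw [hc, sub_mul, div_mul_cancel₀ _ hk1]; ring
    have hk' : 0 < 2 * k - 1 := by linarith
    rw [div_eq_div_iff (by positivity) (by positivity)]
    linear_combination -2 * (n + 1 - k) * hc'
  have h2 : (2 * k + c) / (8 * (n + 1 - k)) - (1 - 25 * j / (4 * n)) =
      ((4 * n * (2 * e - 10 + 5 * c) + 1000 * j ^ 2 - (4 * n - 25 * j) * (80 - 8 * e)) /
        (4 * n * (40 * (n + 1 - k)))) := by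
    have : e = 5 * k - 4 * n + 5 * j + 5 := by linarith
    rw [this]; field_simp; ring
  have hd : 0 < 4 * n * (40 * (n + 1 - k)) := by positivity
  rw [h1, h2, e2, abs_div, abs_of_pos hd, div_le_div_iff₀ hd (by positivity)]
  have hjn : j ≤ n := by linarith
  have a1 : |4 * n * (2 * e - 10 + 5 * c) + 1000 * j ^ 2 - (4 * n - 25 * j) * (80 - 8 * e)| ≤
      1000 * (5 * n + j ^ 2) := by
    rw [abs_le]
    constructor <;> nlinarith [mul_nonneg hn0.le he, mul_nonneg hj he, mul_nonneg hn0.le h3,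
      mul_nonneg hn0.le (sub_nonneg.2 h4), mul_nonneg hn0.le (sub_nonneg.2 he4),
      mul_nonneg hj (sub_nonneg.2 he4), sq_nonneg j]
  have a2 : n / 5 ≤ n + 1 - k := by linarith
  have a3 : 1000 * (5 * n + j ^ 2) * n ^ 2 ≤ 900 * (n + j ^ 2) * (4 * n * (40 * (n / 5))) := by
    nlinarith [mul_nonneg (sq_nonneg n) hn0.le, mul_nonneg (sq_nonneg n) (sq_nonneg j)]
  calc _ ≤ 1000 * (5 * n + j ^ 2) * n ^ 2 := by gcongr
    _ ≤ _ := a3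
    _ ≤ _ := by gcongr

theorem tendsto_integral_exp_neg_mul_sq {c : ℝ} (hc : 0 < c) :
    Tendsto (fun x : ℝ => ∫ t in (0 : ℝ)..x, Real.exp (-c * t ^ 2)) atTop
      (nhds (Real.sqrt (Real.pi / c) / 2)) := by
  rw [← integral_gaussian_Ioi c]
  exact intervalIntegral_tendsto_integral_Ioi 0 (integrable_exp_neg_mul_sq hc).integrableOn
    tendsto_id

theorem abs_integral_exp_neg_mul_sq_le {c : ℝ} (hc : 0 ≤ c) (x y : ℝ) :
    |∫ t in x..y, Real.exp (-c * t ^ 2)| ≤ |y - x| := by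
  have := intervalIntegral.norm_integral_le_of_norm_le_const (a := x) (b := y) (C := 1)
    (f := fun t : ℝ => Real.exp (-c * t ^ 2)) (fun t _ => by
      rw [Real.norm_eq_abs, abs_of_pos (Real.exp_pos _)]
      exact Real.exp_le_one_iff.2 (by nlinarith [sq_nonneg t]))
  simpa using this

theorem integral_Iic_exp_neg_mul_sq {c : ℝ} (hc : 0 < c) (x : ℝ) :
    ∫ t in Set.Iic x, Real.exp (-c * t ^ 2) =
      Real.sqrt (Real.pi / c) / 2 + ∫ t in (0 : ℝ)..x, Real.exp (-c * t ^ 2) := by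
  have hi := integrable_exp_neg_mul_sq hc
  rw [← intervalIntegral.integral_Iic_sub_Iic hi.integrableOn hi.integrableOn,
    ← integral_gaussian_Ioi c]
  have := integral_comp_neg_Iic 0 (fun t : ℝ => Real.exp (-c * t ^ 2))
  simp only [neg_sq, neg_zero] at this
  rw [← this]; ring

theorem abs_integral_Iic_exp_neg_mul_sq_sub_le {c : ℝ} (hc : 0 < c) (x y : ℝ) :
    |(∫ t in Set.Iic y, Real.exp (-c * t ^ 2)) - ∫ t in Set.Iic x, Real.exp (-c * t ^ 2)| ≤
      |y - x| := by
  have hi := integrable_exp_neg_mul_sq hc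
  rw [intervalIntegral.integral_Iic_sub_Iic hi.integrableOn hi.integrableOn]
  exact abs_integral_exp_neg_mul_sq_le hc.le x y

theorem integral_neg_exp_neg_mul_sq (c x : ℝ) :
    ∫ t in (0 : ℝ)..(-x), Real.exp (-c * t ^ 2) = -∫ t in (0 : ℝ)..x, Real.exp (-c * t ^ 2) := by
  have := intervalIntegral.integral_comp_neg (a := 0) (b := x)
    (fun t : ℝ => Real.exp (-c * t ^ 2))
  simp only [neg_sq, neg_zero] at this
  rw [this, intervalIntegral.integral_symm]

theorem tendsto_integral_Iic_exp_neg_mul_sq {c : ℝ} (hc : 0 < c) :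
    Tendsto (fun x : ℝ => ∫ t in Set.Iic x, Real.exp (-c * t ^ 2)) atTop
      (nhds (Real.sqrt (Real.pi / c))) := by
  simp_rw [integral_Iic_exp_neg_mul_sq hc]
  simpa using (tendsto_integral_exp_neg_mul_sq hc).const_add (Real.sqrt (Real.pi / c) / 2)

/-- Gluing one-sided estimates around a mode `m` into an estimate of all initial sums. -/
theorem abs_sum_range_sub_integral_Iic_le {c C : ℝ} (hc : 0 < c) {u : ℕ → ℝ} {m : ℕ}
    (hm : u m = 1)
    (hR : ∀ J : ℕ, |∑ j ∈ Finset.range J, u (m + j)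
      - ∫ t in (0 : ℝ)..J, Real.exp (-c * t ^ 2)| ≤ C)
    (hL : ∀ J : ℕ, |∑ j ∈ Finset.range J, (if j ≤ m then u (m - j) else 0)
      - ∫ t in (0 : ℝ)..J, Real.exp (-c * t ^ 2)| ≤ C) (q : ℕ) :
    |∑ k ∈ Finset.range q, u k - ∫ t in Set.Iic ((q : ℝ) - m), Real.exp (-c * t ^ 2)|
      ≤ 2 * C + 1 := by
  set L : ℕ → ℝ := fun j => if j ≤ m then u (m - j) else 0 with hLdef
  have hrefl : ∑ j ∈ Finset.range (m + 1), L j = ∑ k ∈ Finset.range (m + 1), u k := by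
    rw [← Finset.sum_range_reflect u (m + 1)]
    refine Finset.sum_congr rfl fun j hj => ?_
    rw [Finset.mem_range] at hj
    simp [hLdef, show j ≤ m by omega]
  have hT : |∑ k ∈ Finset.range (m + 1), u k - Real.sqrt (Real.pi / c) / 2| ≤ C := by
    have ht := ((tendsto_integral_exp_neg_mul_sq hc).comp
      tendsto_natCast_atTop_atTop).const_sub (∑ k ∈ Finset.range (m + 1), u k)
    refine le_of_tendsto ht.abs ?_
    filter_upwards [eventually_ge_atTop (m + 1)] with J hJ
    have h := hL J
    rwa [Finset.eventually_constant_sum (N := m + 1)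
      (fun j hj => by simp [show ¬ j ≤ m by omega]) hJ, hrefl] at h
  have hsplit := Finset.sum_range_succ u m
  rw [integral_Iic_exp_neg_mul_sq hc]
  rw [abs_le] at hT ⊢
  rcases le_or_gt m q with hq | hq
  · obtain ⟨p, rfl⟩ := Nat.exists_eq_add_of_le hq
    have h := abs_le.1 (hR p)
    rw [Finset.sum_range_add]
    push_cast
    rw [add_sub_cancel_left]
    constructor <;> linarith
  · obtain ⟨p, rfl⟩ := Nat.exists_eq_add_of_lt hq
    have h := abs_le.1 (hL (p + 2))
    have h1 : ∑ j ∈ Finset.range (p + 2), L j =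
        ∑ j ∈ Finset.range (p + 2), u (q + j) := by
      rw [← Finset.sum_range_reflect (fun j => u (q + j))]
      refine Finset.sum_congr rfl fun j hj => ?_
      rw [Finset.mem_range] at hj
      simp only [hLdef, show j ≤ q + p + 1 by omega, if_true]
      congr 1; omega
    have h2 := Finset.sum_range_add u q (p + 2)
    rw [show q + (p + 2) = q + p + 1 + 1 by ring] at h2
    have h3 : (q : ℝ) - ((q + p + 1 : ℕ) : ℝ) = -((p : ℝ) + 1) := by push_cast; ring
    have h4 := abs_le.1 (abs_integral_Iic_exp_neg_mul_sq_sub_le hc ((p : ℝ) + 1) ((p + 2 : ℕ) : ℝ))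
    rw [integral_Iic_exp_neg_mul_sq hc, integral_Iic_exp_neg_mul_sq hc] at h4
    have h5 : |((p + 2 : ℕ) : ℝ) - (p + 1)| = 1 := by push_cast; norm_num
    rw [h5] at h4
    rw [h3, integral_neg_exp_neg_mul_sq]
    rw [h1] at h
    constructor <;> linarith

theorem integral_Iic_exp_neg_mul_sq_scale {s : ℝ} (hs : 0 < s) (v : ℝ) :
    ∫ t in Set.Iic (s * v), Real.exp (-(1 / (2 * s ^ 2)) * t ^ 2) =
      s * ∫ t in Set.Iic v, Real.exp (-t ^ 2 / 2) := by
  have h := integral_comp_mul_left_Ioi (fun t : ℝ => Real.exp (-(1 / (2 * s ^ 2)) * t ^ 2))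
    (-v) hs
  have h1 := integral_comp_neg_Iic (s * v) (fun t : ℝ => Real.exp (-(1 / (2 * s ^ 2)) * t ^ 2))
  have h2 := integral_comp_neg_Iic v (fun t : ℝ => Real.exp (-t ^ 2 / 2))
  simp only [neg_sq] at h1 h2
  have h3 : ∀ t : ℝ, Real.exp (-(1 / (2 * s ^ 2)) * (s * t) ^ 2) = Real.exp (-t ^ 2 / 2) := by
    intro t; congr 1; field_simp
  simp only [h3, mul_neg, smul_eq_mul] at h
  rw [h1, h2, h]
  field_simp

theorem abs_div_sub_div_le {S T G I C : ℝ} (hS : 0 ≤ S) (hST : S ≤ T) (hT : 0 < T) (hI : 0 < I)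
    (h1 : |S - G| ≤ C) (h2 : |T - I| ≤ C) : |S / T - G / I| ≤ 2 * C / I := by
  have e : S / T - G / I = (S / T * (I - T) + (S - G)) / I := by field_simp; ring
  have h3 : |S / T| ≤ 1 := by
    rw [abs_of_nonneg (by positivity)]; exact (div_le_one hT).2 hST
  rw [e, abs_div, abs_of_pos hI]
  gcongr
  refine (abs_add_le _ _).trans ?_
  rw [abs_mul, abs_sub_comm I T]
  have := mul_le_mul h3 h2 (abs_nonneg _) zero_le_one
  linarith

theorem Ank_succ_mul {n p : ℕ} (hp : p + 1 ≤ n) :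
    (Ank n (p + 3) : ℝ) * ((p + 3) * (p + 1)) =
      Ank n (p + 2) * (2 * (2 * p + 3) * ((n : ℝ) - 1 - p)) := by
  have h1 := congrArg (Nat.cast (R := ℝ)) (Nat.succ_mul_centralBinom_succ (p + 1))
  have h2 := congrArg (Nat.cast (R := ℝ)) (Nat.choose_succ_right_eq (n - 1) p)
  have hn : ((n - 1 - p : ℕ) : ℝ) = (n : ℝ) - 1 - p := by
    rw [Nat.sub_sub, Nat.cast_sub (by omega)]; push_cast; ring
  simp only [Nat.cast_mul, hn] at h1 h2
  simp only [Ank, show 2 * (p + 3) - 2 = 2 * (p + 1 + 1) by omega,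
    show 2 * (p + 2) - 2 = 2 * (p + 1) by omega, show p + 3 - 1 = p + 1 + 1 by omega,
    show p + 2 - 1 = p + 1 by omega, show p + 3 - 2 = p + 1 by omega, Nat.add_sub_cancel,
    ← Nat.centralBinom_eq_two_mul_choose]
  push_cast at h1 h2 ⊢
  field_simp
  linear_combination ((n - 1).choose (p + 1) : ℝ) * (p + 1) * h1 +
    2 * (2 * p + 3) * ((p + 1).centralBinom : ℝ) * h2

theorem Ank_pos {n k : ℕ} (hk : 2 ≤ k) (hkn : k ≤ n + 1) : 0 < Ank n k := by
  have h1 : 0 < Nat.choose (2 * k - 2) (k - 1) := Nat.choose_pos (by omega)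
  have h2 : 0 < Nat.choose (n - 1) (k - 2) := Nat.choose_pos (by omega)
  unfold Ank
  have : (0 : ℚ) < k := by exact_mod_cast (by omega : 0 < k)
  positivity

/-- The numbers `A_{n,k}` extended by zero outside `2 ≤ k ≤ n + 1`, normalized to be `1` at `m`. -/
noncomputable def relAnk (n m k : ℕ) : ℝ :=
  (if 2 ≤ k ∧ k ≤ n + 1 then (Ank n k : ℝ) else 0) / (Ank n m : ℝ)

/-- The ratio `A_{n,k+1} / A_{n,k}` as a function of real arguments. -/
noncomputable def ankRatio (n k : ℝ) : ℝ :=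
  2 * (2 * k - 1) * (n + 1 - k) / ((k + 1) * (k - 1))

theorem relAnk_succ {n m k : ℕ} (hk : 2 ≤ k) :
    relAnk n m (k + 1) = (if k ≤ n + 1 then ankRatio n k else 0) * relAnk n m k := by
  rcases lt_trichotomy k (n + 1) with h | rfl | h
  · obtain ⟨p, rfl⟩ := Nat.exists_eq_add_of_le' hk
    have h1 := Ank_succ_mul (show p + 1 ≤ n by omega)
    simp only [relAnk, ankRatio, h.le, hk, show 2 ≤ p + 2 + 1 by omega,
      show p + 2 + 1 ≤ n + 1 by omega, and_self, if_true]
    have hp : ((p + 2 : ℕ) : ℝ) - 1 = p + 1 := by push_cast; ring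
    rw [← mul_div_assoc]
    congr 1
    rw [hp]
    push_cast
    rw [div_mul_eq_mul_div, eq_div_iff (by positivity)]
    linear_combination h1
  · simp [relAnk, ankRatio]
  · simp [relAnk, show ¬ k ≤ n + 1 by omega, show ¬ k ≤ n by omega]

theorem abs_zero_sub_exp_le {n j : ℝ} (hn : 10 ≤ n) (hj : n / 5 ≤ j) :
    |0 - Real.exp (-(25 / 8 / n) * (2 * j + 1))| ≤ 1000 * (1 / n + j ^ 2 / n ^ 2) := by
  have hn0 : 0 < n := by linarith
  have h1 : Real.exp (-(25 / 8 / n) * (2 * j + 1)) ≤ 1 := by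
    rw [Real.exp_le_one_iff, neg_mul, neg_nonpos]
    exact mul_nonneg (by positivity) (by linarith)
  have h2 : 1 / 25 ≤ j ^ 2 / n ^ 2 := by
    rw [div_le_div_iff₀ (by norm_num) (by positivity)]
    nlinarith
  have h3 : 0 < 1 / n := by positivity
  rw [zero_sub, abs_neg, abs_of_pos (Real.exp_pos _)]
  linarith

theorem relAnk_right_estimate :
    ∃ C : ℝ, ∀ n m : ℕ, 10 ≤ n → 4 * n ≤ 5 * m → 5 * m ≤ 4 * n + 4 → ∀ J : ℕ,
      |∑ j ∈ Finset.range J, relAnk n m (m + j)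
        - ∫ t in (0 : ℝ)..J, Real.exp (-(25 / 8 / (n : ℝ)) * t ^ 2)| ≤ C := by
  obtain ⟨C, hC⟩ := exists_abs_sum_sub_integral_le (a := 5 / 8) (b := 25 / 8) (K := 1000)
    (by norm_num) (by norm_num) (by norm_num)
  refine ⟨C, fun n m hn h1 h2 => ?_⟩
  have hn' : (10 : ℝ) ≤ n := by exact_mod_cast hn
  have h1' : 4 * (n : ℝ) ≤ 5 * m := by exact_mod_cast h1
  have h2' : 5 * (m : ℝ) ≤ 4 * n + 4 := by exact_mod_cast h2
  have hk (j : ℕ) : 5 * ((m + j : ℕ) : ℝ) = 4 * n + 5 * j + (5 * m - 4 * n) := by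
    push_cast; ring
  have hj (j : ℕ) : (0 : ℝ) ≤ j := Nat.cast_nonneg j
  refine hC n (by linarith) (fun j => relAnk n m (m + j))
    (fun j => if m + j ≤ n + 1 then ankRatio n (m + j : ℕ) else 0) ?_
    (fun j => relAnk_succ (show 2 ≤ m + j by omega)) ?_ ?_ ?_
  · have := Ank_pos (n := n) (k := m) (by omega) (by omega)
    have h0 : (Ank n m : ℝ) ≠ 0 := by exact_mod_cast this.ne'
    simp [relAnk, show 2 ≤ m by omega, show m ≤ n + 1 by omega, h0]
  · intro j
    split_ifs with h
    · have hkn : ((m + j : ℕ) : ℝ) ≤ n + 1 := by exact_mod_cast h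
      have := hj j
      have := hk j
      unfold ankRatio
      apply div_nonneg
      · apply mul_nonneg <;> linarith
      · apply mul_nonneg <;> linarith
    · exact le_rfl
  · intro j
    split_ifs with h
    · have hkn : ((m + j : ℕ) : ℝ) ≤ n + 1 := by exact_mod_cast h
      refine (ratio_right_le hn' (hj j) (by linarith) (hk j) hkn).trans ?_
      rw [add_comm]
      exact Real.add_one_le_exp _
    · positivity
  · intro j
    split_ifs with h
    · have hkn : ((m + j : ℕ) : ℝ) ≤ n + 1 := by exact_mod_cast h
      have := abs_sub_exp_le_of_abs_sub_linear_le (by linarith) (hj j)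
        (abs_ratio_right_sub_le hn' (hj j) (by linarith) (by linarith) (hk j) hkn)
      norm_num at this ⊢
      exact this
    · have h3 : n ≤ 5 * j := by omega
      have h3' : (n : ℝ) ≤ 5 * j := by exact_mod_cast h3
      exact abs_zero_sub_exp_le hn' (by linarith)

theorem relAnk_left_estimate :
    ∃ C : ℝ, ∀ n m : ℕ, 10 ≤ n → 4 * n ≤ 5 * m → 5 * m ≤ 4 * n + 4 → ∀ J : ℕ,
      |∑ j ∈ Finset.range J, (if j ≤ m then relAnk n m (m - j) else 0)
        - ∫ t in (0 : ℝ)..J, Real.exp (-(25 / 8 / (n : ℝ)) * t ^ 2)| ≤ C := by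
  obtain ⟨C, hC⟩ := exists_abs_sum_sub_integral_le (a := 5 / 8) (b := 25 / 8) (K := 1000)
    (by norm_num) (by norm_num) (by norm_num)
  refine ⟨C, fun n m hn h1 h2 => ?_⟩
  have hn' : (10 : ℝ) ≤ n := by exact_mod_cast hn
  have h1' : 4 * (n : ℝ) ≤ 5 * m := by exact_mod_cast h1
  have h2' : 5 * (m : ℝ) ≤ 4 * n + 4 := by exact_mod_cast h2
  have hk {j : ℕ} (h : j + 3 ≤ m) :
      5 * ((m - j - 1 : ℕ) : ℝ) = 4 * n + (5 * m - 4 * n) - 5 * j - 5 := by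
    rw [Nat.sub_sub, Nat.cast_sub (by omega)]; push_cast; ring
  have hk2 {j : ℕ} (h : j + 3 ≤ m) : 2 ≤ ((m - j - 1 : ℕ) : ℝ) := by
    exact_mod_cast (by omega : 2 ≤ m - j - 1)
  have hj (j : ℕ) : (0 : ℝ) ≤ j := Nat.cast_nonneg j
  have hinv (k : ℝ) : (ankRatio n k)⁻¹ =
      (k + 1) * (k - 1) / (2 * (2 * k - 1) * (n + 1 - k)) := inv_div _ _
  have hpos {j : ℕ} (h : j + 3 ≤ m) : 0 < ankRatio n (m - j - 1 : ℕ) := by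
    have := hj j
    have := hk h
    have := hk2 h
    unfold ankRatio
    apply div_pos
    · apply mul_pos <;> linarith
    · apply mul_pos <;> linarith
  refine hC n (by linarith) (fun j => if j ≤ m then relAnk n m (m - j) else 0)
    (fun j => if j + 3 ≤ m then (ankRatio n (m - j - 1 : ℕ))⁻¹ else 0) ?_ ?_ ?_ ?_ ?_
  · have := Ank_pos (n := n) (k := m) (by omega) (by omega)
    have h0 : (Ank n m : ℝ) ≠ 0 := by exact_mod_cast this.ne'
    simp [relAnk, show 2 ≤ m by omega, show m ≤ n + 1 by omega, h0]
  · intro j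
    by_cases h : j + 3 ≤ m
    · have h3 := relAnk_succ (n := n) (m := m) (show 2 ≤ m - j - 1 by omega)
      rw [if_pos (show m - j - 1 ≤ n + 1 by omega), show m - j - 1 + 1 = m - j by omega] at h3
      rw [if_pos h, if_pos (by omega), if_pos (by omega), h3,
        inv_mul_cancel_left₀ (hpos h).ne', Nat.sub_sub]
    · rw [if_neg h, zero_mul]
      split_ifs with h3
      · simp [relAnk, show ¬ 2 ≤ m - (j + 1) by omega]
      · rfl
  · intro j
    split_ifs with h
    · exact (inv_pos.2 (hpos h)).le
    · exact le_rfl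
  · intro j
    split_ifs with h
    · rw [hinv]
      refine (ratio_left_le hn' (hj j) (by linarith) (hk h) (hk2 h)).trans ?_
      rw [add_comm]
      exact Real.add_one_le_exp _
    · positivity
  · intro j
    split_ifs with h
    · rw [hinv]
      have := abs_sub_exp_le_of_abs_sub_linear_le (by linarith) (hj j)
        (abs_ratio_left_sub_le hn' (hj j) (by linarith) (by linarith) (hk h) (hk2 h))
      norm_num at this ⊢
      exact this
    · have h3 : n ≤ 5 * j := by omega
      have h3' : (n : ℝ) ≤ 5 * j := by exact_mod_cast h3
      exact abs_zero_sub_exp_le hn' (by linarith)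

theorem sum_filter_Ank_eq (n m : ℕ) (y : ℝ) :
    ((∑ k ∈ (Finset.Icc 2 (n + 1)).filter (fun k : ℕ => (k : ℝ) ≤ y), Ank n k : ℚ) : ℝ)
      / (Ank n m : ℝ) = ∑ k ∈ Finset.range ⌊y + 1⌋₊, relAnk n m k := by
  have h : (Finset.Icc 2 (n + 1)).filter (fun k : ℕ => (k : ℝ) ≤ y) =
      (Finset.range ⌊y + 1⌋₊).filter (fun k => 2 ≤ k ∧ k ≤ n + 1) := by
    ext k
    have : k < ⌊y + 1⌋₊ ↔ (k : ℝ) ≤ y := by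
      rw [← Nat.succ_le_iff, Nat.le_floor_iff' (Nat.succ_ne_zero k)]
      push_cast
      exact add_le_add_iff_right 1
    simp only [Finset.mem_filter, Finset.mem_Icc, Finset.mem_range, this]
    tauto
  rw [h, Finset.sum_filter]
  push_cast
  rw [Finset.sum_div]
  refine Finset.sum_congr rfl fun k _ => ?_
  unfold relAnk
  split_ifs <;> simp

theorem abs_sum_relAnk_sub_integral_le {n m : ℕ} {C : ℝ} (hn : 10 ≤ n) (h1 : 4 * n ≤ 5 * m)
    (h2 : 5 * m ≤ 4 * n + 4)
    (hC : ∀ q : ℕ, |∑ k ∈ Finset.range q, relAnk n m k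
      - ∫ t in Set.Iic ((q : ℝ) - m), Real.exp (-(25 / 8 / (n : ℝ)) * t ^ 2)| ≤ C) (x : ℝ) :
    |∑ k ∈ Finset.range ⌊4 / 5 * (n : ℝ) + x + 1⌋₊, relAnk n m k
      - ∫ t in Set.Iic x, Real.exp (-(25 / 8 / (n : ℝ)) * t ^ 2)| ≤ C + 2 := by
  have hn' : (10 : ℝ) ≤ n := by exact_mod_cast hn
  have h1' : 4 * (n : ℝ) ≤ 5 * m := by exact_mod_cast h1
  have h2' : 5 * (m : ℝ) ≤ 4 * n + 4 := by exact_mod_cast h2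
  have hc : 0 < 25 / 8 / (n : ℝ) := by positivity
  have hlip := abs_integral_Iic_exp_neg_mul_sq_sub_le hc
  rcases le_or_gt 0 (4 / 5 * (n : ℝ) + x + 1) with h | h
  · have h3 := Nat.floor_le h
    have h4 := Nat.lt_floor_add_one (4 / 5 * (n : ℝ) + x + 1)
    set q := ⌊4 / 5 * (n : ℝ) + x + 1⌋₊
    have h5 : |((q : ℝ) - m) - x| ≤ 2 := by rw [abs_le]; constructor <;> linarith
    exact (abs_sub_le _ _ _).trans (add_le_add (hC q) ((hlip _ _).trans h5))
  · rw [Nat.floor_of_nonpos h.le]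
    have h3 := hC 0
    simp only [Finset.range_zero, Finset.sum_empty, Nat.cast_zero, zero_sub, abs_neg] at h3 ⊢
    have hi := integrable_exp_neg_mul_sq hc
    have hnn : ∀ t : ℝ, 0 ≤ Real.exp (-(25 / 8 / (n : ℝ)) * t ^ 2) := fun t => (Real.exp_pos _).le
    have h4 : ∫ t in Set.Iic x, Real.exp (-(25 / 8 / (n : ℝ)) * t ^ 2) ≤
        ∫ t in Set.Iic (-(m : ℝ)), Real.exp (-(25 / 8 / (n : ℝ)) * t ^ 2) :=
      setIntegral_mono_set hi.integrableOn (Eventually.of_forall hnn)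
        (Set.Iic_subset_Iic.2 (by linarith)).eventuallyLE
    rw [abs_of_nonneg (integral_nonneg hnn)] at h3 ⊢
    linarith

/-- Central limit theorem with speed of convergence:
`sup_v |P_n(v) − Φ(v)| = O(1/√n)` where `Φ` is the standard normal distribution
function. -/
theorem vertices_clt :
    ∃ C : ℝ, ∀ᶠ n : ℕ in atTop, ∀ v : ℝ,
      |Pdf n v - (1 / Real.sqrt (2 * Real.pi)) * ∫ t in Set.Iic v, Real.exp (-t ^ 2 / 2)|
        ≤ C / Real.sqrt n := by
  obtain ⟨C₁, hC₁⟩ := relAnk_right_estimate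
  obtain ⟨C₂, hC₂⟩ := relAnk_left_estimate
  set C := 2 * max C₁ C₂ + 1 + 2 with hCdef
  refine ⟨2 * C / (2 / 5 * Real.sqrt (2 * Real.pi)), ?_⟩
  filter_upwards [eventually_ge_atTop 10] with n hn v
  obtain ⟨m, h1, h2⟩ : ∃ m : ℕ, 4 * n ≤ 5 * m ∧ 5 * m ≤ 4 * n + 4 :=
    ⟨(4 * n + 4) / 5, by omega, by omega⟩
  have hn0 : (0 : ℝ) < n := by exact_mod_cast (by omega : 0 < n)
  have hc : 0 < 25 / 8 / (n : ℝ) := by positivity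
  have hsn : 0 < Real.sqrt n := Real.sqrt_pos.2 hn0
  have hsp : 0 < Real.sqrt (2 * Real.pi) := Real.sqrt_pos.2 (by positivity)
  have hAm : (0 : ℝ) < Ank n m := by exact_mod_cast Ank_pos (by omega) (by omega)
  have hm1 : relAnk n m m = 1 := by
    simp [relAnk, show 2 ≤ m by omega, show m ≤ n + 1 by omega, hAm.ne']
  have hest := abs_sum_relAnk_sub_integral_le hn h1 h2 (abs_sum_range_sub_integral_Iic_le hc hm1
    (fun J => (hC₁ n m hn h1 h2 J).trans (le_max_left _ _))
    (fun J => (hC₂ n m hn h1 h2 J).trans (le_max_right _ _)))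
  set I := Real.sqrt (Real.pi / (25 / 8 / (n : ℝ))) with hI
  have hIval : I = 2 / 5 * Real.sqrt n * Real.sqrt (2 * Real.pi) := by
    rw [hI, Real.sqrt_eq_iff_mul_self_eq (by positivity) (by positivity)]
    have e1 := Real.mul_self_sqrt hn0.le
    have e2 := Real.mul_self_sqrt (show 0 ≤ 2 * Real.pi by positivity)
    symm
    calc _ = 4 / 25 * (Real.sqrt n * Real.sqrt n) *
          (Real.sqrt (2 * Real.pi) * Real.sqrt (2 * Real.pi)) := by ring
      _ = _ := by rw [e1, e2]; field_simp; ring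
  set S : ℝ := ((∑ k ∈ (Finset.Icc 2 (n + 1)).filter
        (fun k : ℕ => (k : ℝ) ≤ (4 / 5) * (n : ℝ) + (2 / 5) * Real.sqrt n * v),
      Ank n k : ℚ) : ℝ) / Ank n m with hS
  set T : ℝ := (A n : ℝ) / Ank n m with hT
  have hP : Pdf n v = S / T := by
    rw [hS, hT, div_div_div_cancel_right₀ hAm.ne', Pdf]
    push_cast
    rfl
  have hnonneg : ∀ k ∈ Finset.Icc 2 (n + 1), 0 ≤ Ank n k := fun k hk =>
    (Ank_pos (Finset.mem_Icc.1 hk).1 (Finset.mem_Icc.1 hk).2).le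
  have hS0 : 0 ≤ S := by
    refine div_nonneg ?_ hAm.le
    exact_mod_cast Finset.sum_nonneg fun k hk => hnonneg k (Finset.mem_filter.1 hk).1
  have hST : S ≤ T := by
    refine div_le_div_of_nonneg_right ?_ hAm.le
    exact_mod_cast Finset.sum_le_sum_of_subset_of_nonneg (Finset.filter_subset _ _)
      fun k hk _ => hnonneg k hk
  have hT0 : 0 < T := by
    refine div_pos ?_ hAm
    exact_mod_cast Finset.sum_pos (fun k hk =>
      Ank_pos (Finset.mem_Icc.1 hk).1 (Finset.mem_Icc.1 hk).2) ⟨2, by simp; omega⟩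
  set G := ∫ t in Set.Iic (2 / 5 * Real.sqrt n * v),
    Real.exp (-(25 / 8 / (n : ℝ)) * t ^ 2) with hG
  have hSG : |S - G| ≤ C := by
    rw [hS, sum_filter_Ank_eq]
    exact hest _
  have hTI : |T - I| ≤ C := by
    refine le_of_tendsto ((tendsto_integral_Iic_exp_neg_mul_sq hc).const_sub T).abs ?_
    filter_upwards [eventually_ge_atTop ((n : ℝ) + 1)] with x hx
    have h := hest x
    rw [← sum_filter_Ank_eq, Finset.filter_true_of_mem] at h
    · exact h
    · intro k hk
      have : (k : ℝ) ≤ n + 1 := by exact_mod_cast (Finset.mem_Icc.1 hk).2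
      linarith
  have hGv : G = 2 / 5 * Real.sqrt n * ∫ t in Set.Iic v, Real.exp (-t ^ 2 / 2) := by
    rw [← integral_Iic_exp_neg_mul_sq_scale (by positivity), hG]
    have : 25 / 8 / (n : ℝ) = 1 / (2 * (2 / 5 * Real.sqrt n) ^ 2) := by
      rw [mul_pow, Real.sq_sqrt hn0.le]; field_simp; norm_num
    rw [this]
  have hmain := abs_div_sub_div_le hS0 hST hT0 (show 0 < I by rw [hIval]; positivity) hSG hTI
  have e1 : G / I = 1 / Real.sqrt (2 * Real.pi) * ∫ t in Set.Iic v, Real.exp (-t ^ 2 / 2) := by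
    rw [hGv, hIval]; field_simp
  have e2 : 2 * C / I = 2 * C / (2 / 5 * Real.sqrt (2 * Real.pi)) / Real.sqrt n := by
    rw [hIval]; field_simp
  rw [hP, ← e1, ← e2]
  exact hmain
end

section
/- Let (k_n)_{n≥1} be a sequence of integers with 2 ≤ k_n ≤ n+1 such that (k_n − (4/5)n)/n^{2/3} → 0 as n → ∞. Then A_{n,k_n}/A_n ~ ( 5/(2·√(2πn)) )·exp( −(25/(8n))·(k_n − (4/5)n)² ) as n → ∞, i.e. the ratio of the two sides tends to 1. -/
open Filter

open Topology Stirling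

/-- The probability that a binomial random variable with parameters `n` and `p` equals `j`. -/
noncomputable def binomialMass (p : ℝ) (n j : ℕ) : ℝ :=
  (n.choose j : ℝ) * p ^ j * (1 - p) ^ (n - j)

/-- The Catalan number of index `j + 1`, scaled by `4 ^ (j + 1)`. -/
noncomputable def scaledCatalan (j : ℕ) : ℝ :=
  (Nat.centralBinom (j + 1) : ℝ) / (4 ^ (j + 1) * (j + 2))

theorem abs_one_add_mul_log_sub_le {u : ℝ} (hu : |u| ≤ 1 / 2) :
    |(1 + u) * Real.log (1 + u) - u - u ^ 2 / 2| ≤ 4 * |u| ^ 3 := by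
  have h := Real.abs_log_sub_add_sum_range_le (x := -u) (by rw [abs_neg]; linarith) 2
  simp only [Finset.sum_range_succ, Finset.sum_range_zero, abs_neg] at h
  norm_num at h
  set e := -u + u ^ 2 / 2 + Real.log (1 + u) with he
  have hle : |e| ≤ 2 * |u| ^ 3 := by
    refine h.trans ?_
    rw [div_le_iff₀ (by linarith)]
    nlinarith [pow_nonneg (abs_nonneg u) 3]
  have hid : (1 + u) * Real.log (1 + u) - u - u ^ 2 / 2 = -(u ^ 3 / 2) + (1 + u) * e := by
    rw [he]; ring
  rw [hid]
  refine (abs_add_le _ _).trans ?_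
  rw [abs_neg, abs_div, abs_pow, abs_mul, abs_two]
  have h1 : |1 + u| ≤ 3 / 2 := (abs_add_le _ _).trans (by rw [abs_one]; linarith)
  have h2 : |1 + u| * |e| ≤ 3 / 2 * (2 * |u| ^ 3) := by gcongr
  nlinarith [pow_nonneg (abs_nonneg u) 3]

theorem factorial_eq_stirlingSeq {n : ℕ} (hn : n ≠ 0) :
    (n.factorial : ℝ) =
      stirlingSeq n * Real.sqrt (2 * n) * Real.exp (n * Real.log n - n) := by
  have hpos : (0 : ℝ) < n := by positivity
  have h : Real.exp (n * Real.log n - n) = (n / Real.exp 1) ^ n := by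
    rw [div_pow, ← Real.exp_nat_mul, Real.exp_sub, mul_one, Real.exp_nat_mul, Real.exp_log hpos]
  rw [h, stirlingSeq]
  field_simp

theorem binomialMass_eq_stirlingSeq {p : ℝ} (hp : 0 < p) (hp1 : p < 1) {n j : ℕ} (hj : 0 < j)
    (hjn : j < n) :
    binomialMass p n j = stirlingSeq n / (stirlingSeq j * stirlingSeq (n - j)) *
      Real.sqrt (n / (2 * j * (n - j))) *
      Real.exp (-(j * Real.log (j / (n * p)) +
        (n - j) * Real.log ((n - j) / (n * (1 - p))))) := by
  have hq : 0 < 1 - p := by linarith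
  have hn : 0 < n := by omega
  have hj' : (0 : ℝ) < j := by positivity
  have hn' : (0 : ℝ) < n := by positivity
  have hnj : (0 : ℝ) < (n : ℝ) - j := by
    have : (j : ℝ) < n := by exact_mod_cast hjn
    linarith
  have hS : ∀ m : ℕ, m ≠ 0 → stirlingSeq m ≠ 0 := fun m hm => by
    obtain ⟨l, rfl⟩ := Nat.exists_eq_succ_of_ne_zero hm
    exact (stirlingSeq'_pos l).ne'
  have hSj := hS j hj.ne'
  have hSnj := hS (n - j) (by omega)
  have hpj : p ^ j = Real.exp (j * Real.log p) := by
    rw [Real.exp_nat_mul, Real.exp_log hp]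
  have hqj : (1 - p) ^ (n - j) = Real.exp (((n : ℝ) - j) * Real.log (1 - p)) := by
    rw [← Nat.cast_sub hjn.le, Real.exp_nat_mul, Real.exp_log hq]
  have hsqrt : Real.sqrt (n / (2 * j * (n - j))) =
      Real.sqrt (2 * n) / (Real.sqrt (2 * j) * Real.sqrt (2 * (n - j))) := by
    rw [← Real.sqrt_mul (by positivity), ← Real.sqrt_div (by positivity)]
    congr 1
    field_simp
  rw [binomialMass, Nat.cast_choose ℝ hjn.le, factorial_eq_stirlingSeq hn.ne',
    factorial_eq_stirlingSeq hj.ne', factorial_eq_stirlingSeq (n := n - j) (by omega), hpj, hqj,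
    hsqrt, Nat.cast_sub hjn.le, Real.log_div hj'.ne' (by positivity),
    Real.log_div hnj.ne' (by positivity), Real.log_mul hn'.ne' hp.ne',
    Real.log_mul hn'.ne' hq.ne']
  have hexp : Real.exp (-(j * (Real.log j - (Real.log n + Real.log p)) +
        ((n : ℝ) - j) * (Real.log (n - j) - (Real.log n + Real.log (1 - p))))) =
      Real.exp (n * Real.log n - n) / (Real.exp (j * Real.log j - j) *
        Real.exp (((n : ℝ) - j) * Real.log (n - j) - (n - j))) * Real.exp (j * Real.log p) *
        Real.exp (((n : ℝ) - j) * Real.log (1 - p)) := by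
    rw [← Real.exp_add, ← Real.exp_sub, ← Real.exp_add, ← Real.exp_add]
    congr 1
    ring
  rw [hexp]
  have : Real.sqrt (2 * j) ≠ 0 := by positivity
  have : Real.sqrt (2 * ((n : ℝ) - j)) ≠ 0 := by positivity
  field_simp

theorem tendsto_sub_mul_div_self {p : ℝ} {j : ℕ → ℕ}
    (hj : Tendsto (fun n : ℕ => ((j n : ℝ) - p * n) / (n : ℝ) ^ ((2 : ℝ) / 3)) atTop (𝓝 0)) :
    Tendsto (fun n : ℕ => ((j n : ℝ) - p * n) / n) atTop (𝓝 0) := by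
  have h : Tendsto (fun n : ℕ => (n : ℝ) ^ (-((1 : ℝ) / 3))) atTop (𝓝 0) :=
    (tendsto_rpow_neg_atTop (by norm_num)).comp tendsto_natCast_atTop_atTop
  have h2 := hj.mul h
  rw [zero_mul] at h2
  refine h2.congr' ?_
  filter_upwards [eventually_gt_atTop 0] with n hn
  have hn' : (0 : ℝ) < n := by positivity
  have : (n : ℝ) ^ (-((1 : ℝ) / 3)) = (n : ℝ) ^ ((2 : ℝ) / 3) / n := by
    rw [show -((1 : ℝ) / 3) = 2 / 3 - 1 by norm_num, Real.rpow_sub_one hn'.ne']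
  rw [this]
  have : (n : ℝ) ^ ((2 : ℝ) / 3) ≠ 0 := by positivity
  field_simp

/-- The de Moivre–Laplace local limit theorem in the moderate deviation range. -/
theorem binomialMass_local_limit {p : ℝ} (hp : 0 < p) (hp1 : p < 1) (j : ℕ → ℕ)
    (hj : Tendsto (fun n : ℕ => ((j n : ℝ) - p * n) / (n : ℝ) ^ ((2 : ℝ) / 3)) atTop (𝓝 0)) :
    Tendsto (fun n : ℕ => binomialMass p n (j n) * Real.sqrt (2 * Real.pi * p * (1 - p) * n) *
      Real.exp (((j n : ℝ) - p * n) ^ 2 / (2 * p * (1 - p) * n))) atTop (𝓝 1) := by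
  have hq : 0 < 1 - p := by linarith
  set q := 1 - p with hqdef
  set u : ℕ → ℝ := fun n => ((j n : ℝ) - p * n) / n with hu
  have hcube : Tendsto (fun n : ℕ => (n : ℝ) * u n ^ 3) atTop (𝓝 0) := by
    have h := hj.pow 3
    rw [zero_pow three_ne_zero] at h
    refine h.congr' ?_
    filter_upwards [eventually_gt_atTop 0] with n hn
    have hn' : (0 : ℝ) < n := by positivity
    have : ((n : ℝ) ^ ((2 : ℝ) / 3)) ^ 3 = (n : ℝ) ^ 2 := by
      rw [← Real.rpow_natCast, ← Real.rpow_mul hn'.le]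
      norm_num
    rw [div_pow, this, hu]
    field_simp
  have hu0 : Tendsto u atTop (𝓝 0) := tendsto_sub_mul_div_self hj
  have hju : ∀ᶠ n : ℕ in atTop, (j n : ℝ) = n * (p + u n) := by
    filter_upwards [eventually_gt_atTop 0] with n hn
    have hn' : (n : ℝ) ≠ 0 := by positivity
    rw [hu]
    field_simp
    ring
  clear_value u
  have hu_small : ∀ r > 0, ∀ᶠ n in atTop, |u n| < r := fun r hr => by
    have h := hu0.abs
    rw [abs_zero] at h
    exact h.eventually_lt_const hr
  have hrange : ∀ᶠ n : ℕ in atTop, 0 < j n ∧ j n < n := by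
    filter_upwards [hju, hu_small p hp, hu_small q hq, eventually_gt_atTop 0] with n h h1 h2 hn
    have hn' : (0 : ℝ) < n := by positivity
    rw [abs_lt] at h1 h2
    have a : (0 : ℝ) < j n := by
      rw [h]
      exact mul_pos hn' (by linarith)
    have b : (j n : ℝ) < n := by
      rw [h]
      nlinarith
    exact ⟨by exact_mod_cast a, by exact_mod_cast b⟩
  have hj_top : Tendsto j atTop atTop := by
    rw [← tendsto_natCast_atTop_iff (R := ℝ)]
    refine Tendsto.congr' (hju.mono fun n h => h.symm) ?_
    exact tendsto_natCast_atTop_atTop.atTop_mul_pos (C := p) hp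
      (by simpa using tendsto_const_nhds.add hu0)
  have hnj_top : Tendsto (fun n => n - j n) atTop atTop := by
    rw [← tendsto_natCast_atTop_iff (R := ℝ)]
    have h : Tendsto (fun n : ℕ => (n : ℝ) * (q - u n)) atTop atTop :=
      tendsto_natCast_atTop_atTop.atTop_mul_pos (C := q) hq
        (by simpa using tendsto_const_nhds.sub hu0)
    refine Tendsto.congr' ?_ h
    filter_upwards [hju, hrange] with n h h2
    rw [Nat.cast_sub h2.2.le, h, hqdef]
    ring
  have hpi : (0 : ℝ) < Real.sqrt Real.pi := Real.sqrt_pos.2 Real.pi_pos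
  have hS : Tendsto (fun n => stirlingSeq n / (stirlingSeq (j n) * stirlingSeq (n - j n)) *
      Real.sqrt Real.pi) atTop (𝓝 1) := by
    have h := (tendsto_stirlingSeq_sqrt_pi.div ((tendsto_stirlingSeq_sqrt_pi.comp hj_top).mul
      (tendsto_stirlingSeq_sqrt_pi.comp hnj_top)) (by positivity)).mul_const (Real.sqrt Real.pi)
    refine (h.congr fun n => rfl).trans (le_of_eq ?_)
    congr 1
    field_simp
  have hR : Tendsto (fun n => Real.sqrt (p * q / ((p + u n) * (q - u n)))) atTop (𝓝 1) := by
    have h : Tendsto (fun n => p * q / ((p + u n) * (q - u n))) atTop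
        (𝓝 (p * q / ((p + 0) * (q - 0)))) :=
      tendsto_const_nhds.div ((tendsto_const_nhds.add hu0).mul (tendsto_const_nhds.sub hu0))
        (by rw [add_zero, sub_zero]; positivity)
    rw [add_zero, sub_zero, div_self (by positivity)] at h
    simpa using h.sqrt
  set D : ℕ → ℝ := fun n =>
    n * p * ((1 + u n / p) * Real.log (1 + u n / p) - u n / p - (u n / p) ^ 2 / 2) +
    n * q * ((1 + -u n / q) * Real.log (1 + -u n / q) - -u n / q - (-u n / q) ^ 2 / 2) with hD
  have hD0 : Tendsto D atTop (𝓝 0) := by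
    have hb : Tendsto (fun n : ℕ => (4 / p ^ 2 + 4 / q ^ 2) * |(n : ℝ) * u n ^ 3|) atTop (𝓝 0) := by
      simpa using hcube.abs.const_mul (4 / p ^ 2 + 4 / q ^ 2)
    refine squeeze_zero_norm' ?_ hb
    filter_upwards [hu_small (p / 2) (by positivity), hu_small (q / 2) (by positivity)] with n h1 h2
    have e1 := abs_one_add_mul_log_sub_le (u := u n / p) (by
      rw [abs_div, abs_of_pos hp, div_le_iff₀ hp]; linarith)
    have e2 := abs_one_add_mul_log_sub_le (u := -u n / q) (by
      rw [abs_div, abs_neg, abs_of_pos hq, div_le_iff₀ hq]; linarith)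
    rw [Real.norm_eq_abs, hD]
    refine (abs_add_le _ _).trans ?_
    rw [abs_mul, abs_mul (n * q), abs_of_nonneg (by positivity : 0 ≤ (n : ℝ) * p),
      abs_of_nonneg (by positivity : 0 ≤ (n : ℝ) * q)]
    calc _ ≤ n * p * (4 * |u n / p| ^ 3) + n * q * (4 * |-u n / q| ^ 3) := by gcongr
      _ = _ := by
        rw [abs_div, abs_div, abs_neg, abs_of_pos hp, abs_of_pos hq, abs_mul, abs_pow,
          Nat.abs_cast]
        field_simp
  have hE : Tendsto (fun n => Real.exp (-D n)) atTop (𝓝 1) := by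
    simpa using hD0.neg.rexp
  have hmain := (hS.mul hR).mul hE
  rw [mul_one, mul_one] at hmain
  refine hmain.congr' ?_
  filter_upwards [hju, hrange, hu_small p hp, hu_small q hq] with n h hr h1 h2
  have hn' : (0 : ℝ) < n := by
    have := hr.1.trans hr.2
    positivity
  rw [abs_lt] at h1 h2
  have hpu : 0 < p + u n := by linarith
  have hqu : 0 < q - u n := by linarith
  have hnj : (n : ℝ) - j n = n * (q - u n) := by rw [h, hqdef]; ring
  rw [binomialMass_eq_stirlingSeq hp hp1 hr.1 hr.2, ← hqdef, hnj]
  have hsq : Real.sqrt (n / (2 * j n * (n * (q - u n)))) * Real.sqrt (2 * Real.pi * p * q * n) =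
      Real.sqrt Real.pi * Real.sqrt (p * q / ((p + u n) * (q - u n))) := by
    rw [← Real.sqrt_mul (by positivity), ← Real.sqrt_mul (by positivity), h]
    congr 1
    field_simp
  have hexp : Real.exp (-(j n * Real.log (j n / (n * p)) +
        n * (q - u n) * Real.log (n * (q - u n) / (n * q)))) *
      Real.exp (((j n : ℝ) - p * n) ^ 2 / (2 * p * q * n)) = Real.exp (-D n) := by
    rw [← Real.exp_add, hD]
    beta_reduce
    congr 1
    have a1 : (j n : ℝ) / (n * p) = 1 + u n / p := by rw [h]; field_simp
    have a2 : n * (q - u n) / (n * q) = 1 + -u n / q := by field_simp; ring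
    have a3 : (j n : ℝ) - p * n = n * u n := by rw [h]; ring
    rw [a1, a2, a3, h]
    have hpq : p + q = 1 := by rw [hqdef]; ring
    generalize Real.log (1 + u n / p) = L1
    generalize Real.log (1 + -u n / q) = L2
    have hs : (n * u n) ^ 2 / (2 * p * q * n) =
        n * p * ((u n / p) ^ 2 / 2) + n * q * ((-u n / q) ^ 2 / 2) := by
      field_simp
      linear_combination -(1 : ℝ) * hpq
    rw [hs]
    field_simp
    ring
  linear_combination (-(stirlingSeq n / (stirlingSeq (j n) * stirlingSeq (n - j n))) *
      Real.exp (-D n)) * hsq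
    - (stirlingSeq n / (stirlingSeq (j n) * stirlingSeq (n - j n)) *
      Real.sqrt (n / (2 * j n * (n * (q - u n)))) * Real.sqrt (2 * Real.pi * p * q * n)) * hexp

theorem tendsto_centralBinom_mul_sqrt_div :
    Tendsto (fun m : ℕ => (Nat.centralBinom m : ℝ) * Real.sqrt m / 4 ^ m) atTop
      (𝓝 (Real.sqrt Real.pi)⁻¹) := by
  have hpi : (0 : ℝ) < Real.sqrt Real.pi := Real.sqrt_pos.2 Real.pi_pos
  have h2 : Tendsto (fun m : ℕ => 2 * m) atTop atTop :=
    tendsto_id.const_mul_atTop' two_pos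
  have h := (tendsto_stirlingSeq_sqrt_pi.comp h2).div (tendsto_stirlingSeq_sqrt_pi.pow 2)
    (by positivity)
  have hval : Real.sqrt Real.pi / Real.sqrt Real.pi ^ 2 = (Real.sqrt Real.pi)⁻¹ := by
    field_simp
  rw [hval] at h
  refine h.congr' ?_
  filter_upwards [eventually_gt_atTop 0] with m hm
  have hm' : (0 : ℝ) < m := by positivity
  have hs : Real.sqrt (2 * (2 * m)) = 2 * Real.sqrt m := by
    rw [show (2 : ℝ) * (2 * m) = 2 ^ 2 * m by ring, Real.sqrt_mul (by positivity),
      Real.sqrt_sq (by norm_num)]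
  have hfac : (Nat.centralBinom m : ℝ) = (2 * m).factorial / (m.factorial : ℝ) ^ 2 := by
    rw [Nat.centralBinom, Nat.cast_choose ℝ (by omega : m ≤ 2 * m),
      show 2 * m - m = m by omega, sq]
  have hsm : Real.sqrt m ^ 2 = m := Real.sq_sqrt hm'.le
  have hs2 : Real.sqrt (2 * m) ^ 2 = 2 * m := Real.sq_sqrt (by positivity)
  rw [Pi.div_apply, Function.comp_apply, hfac, stirlingSeq, stirlingSeq, Nat.cast_mul,
    Nat.cast_two, hs, mul_div_assoc 2 (m : ℝ), mul_pow 2 _ (2 * m), pow_mul 2 2 m,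
    pow_mul' ((m : ℝ) / Real.exp 1) 2 m, div_pow (m.factorial : ℝ), mul_pow (Real.sqrt (2 * m)),
    hs2]
  have : (0 : ℝ) < m.factorial := by positivity
  have : 0 < Real.sqrt m := Real.sqrt_pos.2 hm'
  have : 0 < ((m : ℝ) / Real.exp 1) ^ m := by positivity
  generalize ((m : ℝ) / Real.exp 1) ^ m = E at *
  norm_num
  field_simp
  rw [hsm]

theorem tendsto_scaledCatalan_mul :
    Tendsto (fun j : ℕ => scaledCatalan j * (j * Real.sqrt j)) atTop
      (𝓝 (Real.sqrt Real.pi)⁻¹) := by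
  have h1 := tendsto_centralBinom_mul_sqrt_div.comp (tendsto_add_atTop_nat 1)
  have hr : Tendsto (fun j : ℕ => (j : ℝ) / (j + 2)) atTop (𝓝 1) :=
    tendsto_natCast_div_add_atTop 2
  have hs : Tendsto (fun j : ℕ => Real.sqrt ((j : ℝ) / (j + 1))) atTop (𝓝 1) := by
    simpa using (tendsto_natCast_div_add_atTop (1 : ℝ)).sqrt
  have h := (h1.mul hr).mul hs
  rw [mul_one, mul_one] at h
  refine h.congr fun j => ?_
  have : Real.sqrt ((j : ℝ) + 1) ≠ 0 := by positivity
  rw [Function.comp_apply, Real.sqrt_div (by positivity), scaledCatalan]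
  push_cast
  field_simp

theorem scaledCatalan_nonneg (j : ℕ) : 0 ≤ scaledCatalan j := by
  unfold scaledCatalan
  positivity

theorem scaledCatalan_le_one (j : ℕ) : scaledCatalan j ≤ 1 := by
  have h : (Nat.centralBinom (j + 1) : ℝ) ≤ 4 ^ (j + 1) := by
    have := Nat.sum_range_choose (2 * (j + 1))
    rw [pow_mul] at this
    have h2 : Nat.centralBinom (j + 1) ≤ 4 ^ (j + 1) := by
      rw [show (4 : ℕ) = 2 ^ 2 by norm_num, ← this, Nat.centralBinom]
      exact Finset.single_le_sum (f := fun m => (2 * (j + 1)).choose m)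
        (fun _ _ => Nat.zero_le _) (Finset.mem_range.2 (by omega))
    exact_mod_cast h2
  rw [scaledCatalan, div_le_one (by positivity)]
  nlinarith [pow_pos (show (0 : ℝ) < 4 by norm_num) (j + 1), (Nat.cast_nonneg j : (0 : ℝ) ≤ j)]

theorem Ank_eq_binomialMass_mul {n j : ℕ} (hj : j ≤ n) :
    (Ank (n + 1) (j + 2) : ℝ) = 4 * 5 ^ n * (binomialMass (4 / 5) n j * scaledCatalan j) := by
  obtain ⟨m, rfl⟩ := Nat.exists_eq_add_of_le hj
  rw [Ank, binomialMass, scaledCatalan, Nat.centralBinom,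
    show 2 * (j + 2) - 2 = 2 * (j + 1) by omega,
    show j + 2 - 1 = j + 1 by omega, show j + m + 1 - 1 = j + m by omega,
    show j + 2 - 2 = j by omega, show j + m - j = m by omega]
  push_cast
  rw [show (1 : ℝ) - 4 / 5 = 1 / 5 by norm_num, div_pow, div_pow, one_pow, pow_add]
  field_simp
  ring

theorem A_eq_sum_binomialMass_mul (n : ℕ) :
    (A (n + 1) : ℝ) = 4 * 5 ^ n *
      ∑ j ∈ Finset.range (n + 1), binomialMass (4 / 5) n j * scaledCatalan j := by
  have h : Finset.Icc 2 (n + 1 + 1) = (Finset.range (n + 1)).map (addRightEmbedding 2) := by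
    ext x
    simp only [Finset.mem_Icc, Finset.mem_map, Finset.mem_range, addRightEmbedding_apply]
    constructor
    · intro hx
      exact ⟨x - 2, by omega, by omega⟩
    · rintro ⟨y, hy, rfl⟩
      omega
  rw [A, h, Finset.sum_map, Finset.mul_sum]
  push_cast
  refine Finset.sum_congr rfl fun j hj => ?_
  exact Ank_eq_binomialMass_mul (Finset.mem_range_succ_iff.1 hj)

theorem sum_binomialMass (p : ℝ) (n : ℕ) :
    ∑ j ∈ Finset.range (n + 1), binomialMass p n j = 1 := by
  have h := add_pow p (1 - p) n
  rw [add_sub_cancel, one_pow] at h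
  rw [h]
  exact Finset.sum_congr rfl fun j _ => by rw [binomialMass]; ring

theorem binomialMass_nonneg {p : ℝ} (hp : 0 ≤ p) (hp1 : p ≤ 1) (n j : ℕ) :
    0 ≤ binomialMass p n j := by
  have : 0 ≤ 1 - p := by linarith
  unfold binomialMass
  positivity

/-- The weak law of large numbers for binomial random variables, from Bernstein's theorem. -/
theorem tendsto_sum_binomialMass_mul {p : ℝ} (hp : 0 ≤ p) (hp1 : p ≤ 1) {f : ℝ → ℝ}
    (hf : Continuous f) :
    Tendsto (fun n : ℕ => ∑ j ∈ Finset.range (n + 1), binomialMass p n j * f (j / n)) atTop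
      (𝓝 (f p)) := by
  let F : C(unitInterval, ℝ) := ⟨fun x => f x, hf.comp continuous_subtype_val⟩
  let x : unitInterval := ⟨p, hp, hp1⟩
  have h := ((continuous_eval_const x).tendsto F).comp
    (bernsteinApproximation_uniform F)
  refine h.congr fun n => ?_
  rw [Function.comp_apply, bernsteinApproximation.apply, Finset.sum_range]
  refine Finset.sum_congr rfl fun j _ => ?_
  rw [bernstein_apply, smul_eq_mul]
  rfl

theorem binomialMass_le_of_two_mul_le {n j : ℕ} (hj : 2 * j ≤ n) :
    binomialMass (4 / 5) n j ≤ n.choose j * (2 / 5) ^ n := by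
  have h4 : (4 : ℝ) ^ j ≤ 2 ^ n := by
    rw [show (4 : ℝ) = 2 ^ 2 by norm_num, ← pow_mul]
    exact pow_le_pow_right₀ (by norm_num) hj
  have h : binomialMass (4 / 5) n j = n.choose j * (4 ^ j / 5 ^ n) := by
    obtain ⟨m, rfl⟩ := Nat.exists_eq_add_of_le (show j ≤ n by omega)
    rw [binomialMass, show (1 : ℝ) - 4 / 5 = 1 / 5 by norm_num, div_pow, div_pow, one_pow,
      pow_add, show j + m - j = m by omega]
    field_simp
  rw [h, div_pow]
  gcongr

theorem mul_sqrt_div {a b : ℝ} (hb : 0 ≤ b) :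
    a / b * Real.sqrt (a / b) = a * Real.sqrt a / (b * Real.sqrt b) := by
  rw [Real.sqrt_div' _ hb, div_mul_div_comm]

theorem tendsto_mul_sum_binomialMass_mul_scaledCatalan :
    Tendsto (fun n : ℕ => (n * Real.sqrt n) *
      ∑ j ∈ Finset.range (n + 1), binomialMass (4 / 5) n j * scaledCatalan j) atTop
      (𝓝 ((Real.sqrt Real.pi)⁻¹ / (4 / 5 * Real.sqrt (4 / 5)))) := by
  set c := (Real.sqrt Real.pi)⁻¹ with hc
  have hc0 : 0 ≤ c := by positivity
  set f : ℝ → ℝ := fun x => c / (max x (1 / 2) * Real.sqrt (max x (1 / 2))) with hf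
  have hmax : ∀ x : ℝ, 0 < max x (1 / 2) * Real.sqrt (max x (1 / 2)) := fun x => by
    have : 0 < max x (1 / 2) := lt_max_of_lt_right (by norm_num)
    positivity
  have hfc : Continuous f := by
    refine continuous_const.div (by fun_prop) fun x => (hmax x).ne'
  have hf_le : ∀ x, f x ≤ 4 * c := fun x => by
    have h1 : (1 / 2 : ℝ) ≤ max x (1 / 2) := le_max_right _ _
    have h2 : (1 / 2 : ℝ) ≤ Real.sqrt (max x (1 / 2)) := by
      refine Real.le_sqrt_of_sq_le (le_trans (by norm_num) h1)
    rw [hf]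
    beta_reduce
    rw [div_le_iff₀ (hmax x)]
    have : (1 / 4 : ℝ) ≤ max x (1 / 2) * Real.sqrt (max x (1 / 2)) := by
      nlinarith
    nlinarith
  have hf_nonneg : ∀ x, 0 ≤ f x := fun x => div_nonneg hc0 (hmax x).le
  have hlaw := tendsto_sum_binomialMass_mul (p := 4 / 5) (by norm_num) (by norm_num) hfc
  have hfp : f (4 / 5) = c / (4 / 5 * Real.sqrt (4 / 5)) := by
    rw [hf]
    beta_reduce
    rw [max_eq_left (by norm_num)]
  rw [hfp] at hlaw
  suffices hdiff : Tendsto (fun n : ℕ => ∑ j ∈ Finset.range (n + 1), binomialMass (4 / 5) n j *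
      (n * Real.sqrt n * scaledCatalan j - f (j / n))) atTop (𝓝 0) by
    have h := hdiff.add hlaw
    rw [zero_add] at h
    refine h.congr fun n => ?_
    rw [← Finset.sum_add_distrib, Finset.mul_sum]
    exact Finset.sum_congr rfl fun j _ => by ring
  have htail : Tendsto (fun n : ℕ => ((n : ℝ) ^ 2 + 4 * c) * (4 / 5 : ℝ) ^ n) atTop (𝓝 0) := by
    have h1 := tendsto_pow_const_mul_const_pow_of_abs_lt_one 2
      (r := (4 / 5 : ℝ)) (by rw [abs_of_pos] <;> norm_num)
    have h2 := (tendsto_pow_atTop_nhds_zero_of_lt_one (r := (4 / 5 : ℝ)) (by norm_num)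
      (by norm_num)).const_mul (4 * c)
    have h := h1.add h2
    rw [mul_zero, add_zero] at h
    exact h.congr fun n => by ring
  rw [Metric.tendsto_atTop]
  intro ε hε
  obtain ⟨J, hJ⟩ := Metric.tendsto_atTop.1 tendsto_scaledCatalan_mul (ε / 8) (by positivity)
  obtain ⟨M, hM⟩ := Metric.tendsto_atTop.1 htail (ε / 2) (by positivity)
  refine ⟨max (2 * J + 1) M, fun n hn => ?_⟩
  have hnJ : 2 * J + 1 ≤ n := (le_max_left _ _).trans hn
  have hn1 : (1 : ℝ) ≤ n := by exact_mod_cast (by omega : 1 ≤ n)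
  have hn0 : (0 : ℝ) < n := by linarith
  have hsn : Real.sqrt n ≤ n := Real.sqrt_le_iff.2 ⟨hn0.le, by nlinarith⟩
  have hpoint : ∀ j, |binomialMass (4 / 5) n j *
      (n * Real.sqrt n * scaledCatalan j - f (j / n))| ≤ binomialMass (4 / 5) n j * (ε / 2) +
        (n.choose j * (2 / 5) ^ n) * ((n : ℝ) ^ 2 + 4 * c) := fun j => by
    have hb := binomialMass_nonneg (p := 4 / 5) (by norm_num) (by norm_num) n j
    rw [abs_mul, abs_of_nonneg hb]
    by_cases hj : 2 * j ≤ n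
    · have hd : |n * Real.sqrt n * scaledCatalan j - f (j / n)| ≤ (n : ℝ) ^ 2 + 4 * c := by
        have h1 : n * Real.sqrt n * scaledCatalan j ≤ (n : ℝ) ^ 2 := by
          calc n * Real.sqrt n * scaledCatalan j ≤ n * n * 1 := by
                gcongr
                · exact scaledCatalan_nonneg j
                · exact scaledCatalan_le_one j
            _ = (n : ℝ) ^ 2 := by ring
        have h2 : 0 ≤ n * Real.sqrt n * scaledCatalan j :=
          mul_nonneg (by positivity) (scaledCatalan_nonneg j)
        rw [abs_le]
        constructor <;> nlinarith [hf_le (j / n), hf_nonneg (j / n)]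
      have h1 := mul_le_mul (binomialMass_le_of_two_mul_le hj) hd (abs_nonneg _) (by positivity)
      have h2 : 0 ≤ binomialMass (4 / 5) n j * (ε / 2) := by positivity
      linarith
    · push Not at hj
      have hj0 : (0 : ℝ) < j := by
        have : 0 < j := by omega
        positivity
      have hhalf : (1 / 2 : ℝ) ≤ j / n := by
        have : (n : ℝ) ≤ 2 * j := by exact_mod_cast hj.le
        rw [le_div_iff₀ hn0]
        linarith
      have hw : 0 < (j : ℝ) * Real.sqrt j := by positivity
      have hwn : 0 < (n : ℝ) * Real.sqrt n := by positivity
      have hid : n * Real.sqrt n * scaledCatalan j - f (j / n) =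
          (scaledCatalan j * (j * Real.sqrt j) - c) /
            ((j : ℝ) / n * Real.sqrt ((j : ℝ) / n)) := by
        rw [hf]
        beta_reduce
        rw [max_eq_left hhalf, mul_sqrt_div hn0.le]
        field_simp
      have hquarter : (1 / 4 : ℝ) ≤ (j : ℝ) / n * Real.sqrt ((j : ℝ) / n) := by
        have h2 : (1 / 2 : ℝ) ≤ Real.sqrt ((j : ℝ) / n) :=
          Real.le_sqrt_of_sq_le (le_trans (by norm_num) hhalf)
        nlinarith
      have hclose := hJ j (by omega)
      rw [Real.dist_eq] at hclose
      have hd : |n * Real.sqrt n * scaledCatalan j - f (j / n)| ≤ ε / 2 := by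
        rw [hid, abs_div, abs_of_pos (lt_of_lt_of_le (by norm_num) hquarter),
          div_le_iff₀ (lt_of_lt_of_le (by norm_num) hquarter)]
        nlinarith
      have h1 := mul_le_mul_of_nonneg_left hd hb
      have h2 : 0 ≤ (n.choose j * (2 / 5 : ℝ) ^ n) * ((n : ℝ) ^ 2 + 4 * c) := by positivity
      linarith
  have hM' := hM n ((le_max_right _ _).trans hn)
  rw [Real.dist_eq, sub_zero, abs_of_nonneg (by positivity)] at hM'
  rw [Real.dist_eq, sub_zero]
  calc _ ≤ ∑ j ∈ Finset.range (n + 1), (binomialMass (4 / 5) n j * (ε / 2) +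
        (n.choose j * (2 / 5 : ℝ) ^ n) * ((n : ℝ) ^ 2 + 4 * c)) :=
        (Finset.abs_sum_le_sum_abs _ _).trans (Finset.sum_le_sum fun j _ => hpoint j)
    _ = ε / 2 + ((n : ℝ) ^ 2 + 4 * c) * (4 / 5 : ℝ) ^ n := by
        have hchoose : ∑ j ∈ Finset.range (n + 1), (n.choose j : ℝ) = 2 ^ n := by
          exact_mod_cast Nat.sum_range_choose n
        rw [Finset.sum_add_distrib, ← Finset.sum_mul, ← Finset.sum_mul, ← Finset.sum_mul,
          sum_binomialMass, hchoose, ← mul_pow]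
        norm_num
        ring
    _ < ε := by linarith

/-- Local limit theorem for the number of vertices: if `2 ≤ k_n ≤ n+1` and
`(k_n − (4/5)n)/n^{2/3} → 0`, then
`A_{n,k_n}/A_n ~ (5/(2√(2πn)))·exp(−(25/(8n))·(k_n − (4/5)n)²)`. -/
theorem vertices_local_limit (k : ℕ → ℕ)
    (hk : ∀ n : ℕ, 1 ≤ n → 2 ≤ k n ∧ k n ≤ n + 1)
    (hlim : Tendsto (fun n : ℕ => ((k n : ℝ) - (4 / 5) * (n : ℝ)) / (n : ℝ) ^ ((2 : ℝ) / 3))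
      atTop (nhds 0)) :
    Tendsto (fun n : ℕ =>
        ((Ank n (k n) / A n : ℚ) : ℝ) /
          ((5 / (2 * Real.sqrt (2 * Real.pi * n))) *
            Real.exp (-(25 / (8 * (n : ℝ))) * ((k n : ℝ) - (4 / 5) * (n : ℝ)) ^ 2)))
      atTop (nhds 1) := by
  rw [← tendsto_add_atTop_iff_nat 1]
  set j : ℕ → ℕ := fun n => k (n + 1) - 2 with hjdef
  have hkj : ∀ n, k (n + 1) = j n + 2 := fun n => by
    have := hk (n + 1) (by omega)
    simp only [hjdef]
    omega
  have hjn : ∀ n, j n ≤ n := fun n => by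
    have := hk (n + 1) (by omega)
    have := hkj n
    omega
  clear_value j
  have hratio : Tendsto (fun n : ℕ => ((n : ℝ) + 1) / n) atTop (𝓝 1) := by
    simpa using (tendsto_natCast_div_add_atTop (1 : ℝ)).inv₀ one_ne_zero
  have hinv : Tendsto (fun n : ℕ => (1 : ℝ) / ((n : ℝ) + 1)) atTop (𝓝 0) :=
    tendsto_one_div_add_atTop_nhds_zero_nat
  have hj : Tendsto (fun n : ℕ => ((j n : ℝ) - 4 / 5 * n) / (n : ℝ) ^ ((2 : ℝ) / 3)) atTop
      (𝓝 0) := by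
    have h1 := ((tendsto_add_atTop_iff_nat 1).2 hlim).mul
      (hratio.rpow_const (p := 2 / 3) (Or.inl one_ne_zero))
    have h2 : Tendsto (fun n : ℕ => (n : ℝ) ^ (-((2 : ℝ) / 3))) atTop (𝓝 0) :=
      (tendsto_rpow_neg_atTop (by norm_num)).comp tendsto_natCast_atTop_atTop
    have h := h1.sub (h2.const_mul (6 / 5))
    rw [zero_mul, mul_zero, sub_zero] at h
    refine h.congr' ?_
    filter_upwards [eventually_gt_atTop 0] with n hn
    have hn' : (0 : ℝ) < n := by positivity
    rw [hkj, Real.div_rpow (by positivity) hn'.le, Real.rpow_neg hn'.le]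
    push_cast
    have : ((n : ℝ) + 1) ^ ((2 : ℝ) / 3) ≠ 0 := by positivity
    have : (n : ℝ) ^ ((2 : ℝ) / 3) ≠ 0 := by positivity
    field_simp
    ring
  have hv := tendsto_sub_mul_div_self hj
  have hfrac : Tendsto (fun n : ℕ => (j n : ℝ) / n) atTop (𝓝 (4 / 5)) := by
    have h := hv.add_const (4 / 5 : ℝ)
    rw [zero_add] at h
    refine h.congr' ?_
    filter_upwards [eventually_gt_atTop 0] with n hn
    have hn' : (n : ℝ) ≠ 0 := by positivity
    field_simp
    ring
  have hj_top : Tendsto j atTop atTop := by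
    rw [← tendsto_natCast_atTop_iff (R := ℝ)]
    refine Tendsto.congr' ?_ (tendsto_natCast_atTop_atTop.atTop_mul_pos (by norm_num) hfrac)
    filter_upwards [eventually_gt_atTop 0] with n hn
    have hn' : (n : ℝ) ≠ 0 := by positivity
    field_simp
  have hlocal := binomialMass_local_limit (p := 4 / 5) (by norm_num) (by norm_num) j hj
  have hcat : Tendsto (fun n : ℕ => n * Real.sqrt n * scaledCatalan (j n)) atTop
      (𝓝 ((Real.sqrt Real.pi)⁻¹ / (4 / 5 * Real.sqrt (4 / 5)))) := by
    have h := (tendsto_scaledCatalan_mul.comp hj_top).div (hfrac.mul hfrac.sqrt) (by positivity)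
    refine h.congr' ?_
    filter_upwards [eventually_gt_atTop 0, hj_top.eventually_gt_atTop 0] with n hn hjpos
    have hn' : (0 : ℝ) < n := by positivity
    have hj' : (0 : ℝ) < j n := by exact_mod_cast hjpos
    simp only [Pi.div_apply, Function.comp_apply]
    rw [mul_sqrt_div hn'.le]
    field_simp
  have hpi : (0 : ℝ) < Real.sqrt Real.pi := Real.sqrt_pos.2 Real.pi_pos
  have hquot := hcat.div tendsto_mul_sum_binomialMass_mul_scaledCatalan (by positivity)
  rw [div_self (by positivity)] at hquot
  have hexp : Tendsto (fun n : ℕ => Real.exp (25 / 8 * (((j n : ℝ) + 6 / 5 - 4 / 5 * n) ^ 2 /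
      (n + 1) - ((j n : ℝ) - 4 / 5 * n) ^ 2 / n))) atTop (𝓝 1) := by
    have h := ((((tendsto_natCast_div_add_atTop (1 : ℝ)).mul
      ((hv.const_mul (12 / 5)).sub (hv.pow 2))).add (hinv.const_mul (36 / 25))).const_mul
        (25 / 8)).rexp
    norm_num at h
    refine h.congr' ?_
    filter_upwards [eventually_gt_atTop 0] with n hn
    have hn' : (n : ℝ) ≠ 0 := by positivity
    have hn1 : (n : ℝ) + 1 ≠ 0 := by positivity
    congr 1
    field_simp
    ring
  have hmain := ((hlocal.mul hquot).mul hratio.sqrt).mul hexp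
  rw [Real.sqrt_one, mul_one, mul_one, mul_one] at hmain
  refine hmain.congr' ?_
  filter_upwards [eventually_gt_atTop 0] with n hn
  have hn' : (0 : ℝ) < n := by positivity
  have hsn : 0 < Real.sqrt n := Real.sqrt_pos.2 hn'
  have hsn1 : 0 < Real.sqrt ((n : ℝ) + 1) := Real.sqrt_pos.2 (by positivity)
  have hs1 : Real.sqrt (2 * Real.pi * (4 / 5) * (1 - 4 / 5) * n) =
      2 / 5 * (Real.sqrt (2 * Real.pi) * Real.sqrt n) := by
    rw [← Real.sqrt_mul (by positivity), show 2 * Real.pi * (4 / 5) * (1 - 4 / 5) * n =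
      (2 / 5) ^ 2 * (2 * Real.pi * n) by ring, Real.sqrt_mul (by positivity),
      Real.sqrt_sq (by norm_num)]
  have hs2 : 0 < Real.sqrt (2 * Real.pi) := Real.sqrt_pos.2 (by positivity)
  have hexps : Real.exp (((j n : ℝ) - 4 / 5 * n) ^ 2 / (2 * (4 / 5) * (1 - 4 / 5) * n)) *
      Real.exp (25 / 8 * (((j n : ℝ) + 6 / 5 - 4 / 5 * n) ^ 2 / (n + 1) -
        ((j n : ℝ) - 4 / 5 * n) ^ 2 / n)) =
      (Real.exp (-(25 / (8 * ((n : ℝ) + 1))) * ((j n : ℝ) + 2 - 4 / 5 * (n + 1)) ^ 2))⁻¹ := by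
    rw [← Real.exp_add, ← Real.exp_neg]
    congr 1
    field_simp
    ring
  rw [hkj, Rat.cast_div, Ank_eq_binomialMass_mul (hjn n), A_eq_sum_binomialMass_mul]
  push_cast
  rw [Real.sqrt_mul (by positivity) ((n : ℝ) + 1), Real.sqrt_div (by positivity),
    div_mul_eq_div_div _ _ (Real.exp _), div_eq_mul_inv _ (Real.exp _), ← hexps, hs1,
    Pi.div_apply]
  generalize ∑ j ∈ Finset.range (n + 1), binomialMass (4 / 5) n j * scaledCatalan j = s
  field_simp
end
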